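/- Let X and Y be completely regular topological spaces, let μ be a non-atomic Radon probability measure on X and ν a Radon probability measure on Y, and suppose μ and ν are concentrated on countable unions of metrizable compact sets. Let T be a metric space and let h : X × Y × T → [0,∞) be a continuous function such that h(x,y,t) ≤ a_t(x) + b_t(y), where a_t ∈ L¹(μ), b_t ∈ L¹(ν) are nonnegative Borel functions with lim_{R→+∞} sup_{t∈T} ( ∫_{{a_t ≥ R}} a_t dμ + ∫_{{b_t ≥ R}} b_t dν ) = 0. Then for every ε > 0 one can select ε-optimal Monge mappings T_t^ε : X → Y for the cost functions h_t = h(·,·,t) and marginals (μ, ν) such that μ∘(T_t^ε)⁻¹ = ν for every t and the family (T_t^ε) is continuous in t in the sense of convergence μ-a.e. -/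

import Mathlib

open MeasureTheory Filter Topology

noncomputable section

/-- `σ` is a coupling of `μ` and `ν`, i.e. an element of `Π(μ, ν)`: a measure on the
product whose projections onto the factors are `μ` and `ν`. -/
def IsCoupling {X Y : Type*} [MeasurableSpace X] [MeasurableSpace Y]
    (σ : Measure (X × Y)) (μ : Measure X) (ν : Measure Y) : Prop :=
  σ.map Prod.fst = μ ∧ σ.map Prod.snd = ν

/-- The Kantorovich optimal transportation cost
`K_h(μ, ν) = inf {∫ h dσ : σ ∈ Π(μ, ν)}` (for a nonnegative cost `h`). -/
def kantorovichCost {X Y : Type*} [MeasurableSpace X] [MeasurableSpace Y]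
    (h : X → Y → ℝ) (μ : Measure X) (ν : Measure Y) : ENNReal :=
  ⨅ (σ : Measure (X × Y)) (_ : IsCoupling σ μ ν), ∫⁻ p, ENNReal.ofReal (h p.1 p.2) ∂σ

/-- A family of measures `t ↦ μ t` is continuous in the weak topology generated by
integration against bounded continuous functions. -/
def WeaklyContinuousFamily {T X : Type*} [TopologicalSpace T] [TopologicalSpace X]
    [MeasurableSpace X] (μ : T → Measure X) : Prop :=
  ∀ f : BoundedContinuousFunction X ℝ, Continuous fun t => ∫ x, f x ∂(μ t)


lemma aux_param {X : Type*} [TopologicalSpace X] [CompletelyRegularSpace X]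
    [MeasurableSpace X] [BorelSpace X] (μ : Measure X) [IsProbabilityMeasure μ]
    (hconc : ∃ K : ℕ → Set X, (∀ n, IsCompact (K n)) ∧
      (∀ n, TopologicalSpace.MetrizableSpace (K n)) ∧ μ (⋃ n, K n) = 1) :
    ∃ (C : Set ℝ) (ψ : ℝ → X) (e : X → ℝ), IsClosed C ∧ ContinuousOn ψ C ∧
      Measurable ψ ∧ Measurable e ∧ ∀ᵐ x ∂μ, e x ∈ C ∧ Inseparable (ψ (e x)) x := by
  classical
  obtain ⟨K, hK, hKm, hK1⟩ := hconc
  obtain ⟨x0⟩ : Nonempty X := nonempty_of_isProbabilityMeasure μ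
  -- surjections from the Cantor space
  have hf : ∀ n, ∃ f : (ℕ → Bool) → X, Continuous f ∧ K n ⊆ Set.range f := by
    intro n
    rcases (K n).eq_empty_or_nonempty with h0 | h0
    · exact ⟨fun _ => x0, continuous_const, by simp [h0]⟩
    · have := hKm n
      let _ := TopologicalSpace.metrizableSpaceMetric (K n)
      have : CompactSpace (K n) := isCompact_iff_compactSpace.1 (hK n)
      have : Nonempty (K n) := h0.to_subtype
      obtain ⟨f, hf, hs⟩ := exists_nat_bool_continuous_surjective_of_compact (K n)
      refine ⟨fun b => (f b : X), continuous_subtype_val.comp hf, fun x hx => ?_⟩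
      obtain ⟨b, hb⟩ := hs ⟨x, hx⟩
      exact ⟨b, by simp [hb]⟩
  choose f hfc hfs using hf
  let Cn : ℕ → Set ℝ := fun n => (fun r => r - 2 * (n : ℝ)) ⁻¹' cantorSet
  have hCn : ∀ n r, r ∈ Cn n → 2 * (n : ℝ) ≤ r ∧ r ≤ 2 * n + 1 := by
    intro n r hr
    have := cantorSet_subset_unitInterval hr
    simp only [Set.mem_Icc] at this
    constructor <;> linarith [this.1, this.2]
  have hCnc : ∀ n, IsClosed (Cn n) := fun n =>
    isClosed_cantorSet.preimage (by fun_prop)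
  have hlf : LocallyFinite Cn := by
    intro r
    refine ⟨Metric.ball r 1, Metric.ball_mem_nhds _ one_pos, ?_⟩
    refine (Set.finite_Iic (⌈r + 1⌉₊)).subset ?_
    rintro n ⟨s, hs, hs2⟩
    have := hCn n s hs
    rw [Metric.mem_ball, Real.dist_eq, abs_lt] at hs2
    have h1 := Nat.le_ceil (r + 1)
    have : (n : ℝ) ≤ (⌈r + 1⌉₊ : ℝ) := by
      have : (0 : ℝ) ≤ n := Nat.cast_nonneg n
      linarith
    exact_mod_cast this
  let C := ⋃ n, Cn n
  have hCc : IsClosed C := hlf.isClosed_iUnion hCnc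
  let φ : ℕ → ℝ → X := fun n r =>
    if hr : r - 2 * (n : ℝ) ∈ cantorSet then f n (cantorSetHomeomorphNatToBool ⟨_, hr⟩) else x0
  let ψ : ℝ → X := fun r => if r ∈ C then φ ⌊r / 2⌋₊ r else x0
  have hfl : ∀ n r, r ∈ Cn n → ⌊r / 2⌋₊ = n := by
    intro n r hr
    have := hCn n r hr
    rw [Nat.floor_eq_iff (by have : (0 : ℝ) ≤ n := Nat.cast_nonneg n
                             linarith)]
    constructor <;> linarith
  have hψ : ∀ n r (hr : r ∈ Cn n), ψ r = f n (cantorSetHomeomorphNatToBool ⟨_, hr⟩) := by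
    intro n r hr
    have h1 : r ∈ C := Set.mem_iUnion.2 ⟨n, hr⟩
    have h2 : r - 2 * (n : ℝ) ∈ cantorSet := hr
    simp only [ψ, h1, if_true, hfl n r hr, φ, h2, dif_pos]
  have hψc : ContinuousOn ψ C := by
    refine hlf.continuousOn_iUnion hCnc fun n => ?_
    rw [continuousOn_iff_continuous_domRestrict]
    have : (Cn n).domRestrict ψ = fun r : Cn n =>
        f n (cantorSetHomeomorphNatToBool ⟨(r : ℝ) - 2 * (n : ℝ), r.2⟩) := by
      funext r
      exact hψ n r r.2
    rw [this]
    refine (hfc n).comp (cantorSetHomeomorphNatToBool.continuous.comp ?_)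
    exact Continuous.subtype_mk (by fun_prop) _
  have hψm : Measurable ψ := by
    have : ψ = C.piecewise ψ (fun _ => x0) := by
      funext r
      by_cases hr : r ∈ C <;> simp [hr, ψ]
    rw [this]
    exact hψc.measurable_piecewise continuousOn_const hCc.measurableSet
  have hC0 : ∀ r ∈ C, 0 ≤ r := by
    intro r hr
    obtain ⟨n, hn⟩ := Set.mem_iUnion.1 hr
    have := hCn n r hn
    have h2 : (0 : ℝ) ≤ n := Nat.cast_nonneg n
    linarith
  let A : X → Set ℝ := fun x => C ∩ ψ ⁻¹' (closure {x})
  have hAc : ∀ x, IsClosed (A x) := fun x =>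
    hψc.preimage_isClosed_of_isClosed hCc isClosed_closure
  have hins : ∀ x y : X, y ∈ closure {x} ↔ Inseparable y x := by
    intro x y
    rw [← specializes_iff_mem_closure, specializes_iff_inseparable]; exact ⟨fun h => h.symm, fun h => h.symm⟩
  have hAbdd : ∀ x, BddBelow (A x) := fun x => ⟨0, fun r hr => hC0 r hr.1⟩
  let e : X → ℝ := fun x => sInf (A x)
  have heA : ∀ x, (A x).Nonempty → e x ∈ A x := fun x hx =>
    (hAc x).csInf_mem hx (hAbdd x)
  let B : ℝ → Set X := fun c => closure (ψ '' (C ∩ Set.Icc 0 c))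
  have hB : ∀ c x, x ∈ B c ↔ ∃ r ∈ A x, r ≤ c := by
    intro c x
    have hcomp : IsCompact (ψ '' (C ∩ Set.Icc 0 c)) :=
      (isCompact_Icc.inter_left hCc).image_of_continuousOn (hψc.mono Set.inter_subset_left)
    simp only [B]
    rw [hcomp.closure_eq_biUnion_inseparable]
    simp only [Set.mem_iUnion, Set.mem_ofPred_eq, exists_prop]
    constructor
    · rintro ⟨_, ⟨r, ⟨hrC, hr⟩, rfl⟩, hx⟩
      exact ⟨r, ⟨hrC, (hins _ _).2 hx⟩, hr.2⟩
    · rintro ⟨r, ⟨hrC, hx⟩, hr⟩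
      exact ⟨_, ⟨r, ⟨hrC, hC0 r hrC, hr⟩, rfl⟩, (hins _ _).1 hx⟩
  let D : Set X := ⋃ n : ℕ, B n
  have hD : ∀ x, x ∈ D ↔ (A x).Nonempty := by
    intro x
    simp only [D, Set.mem_iUnion, hB]
    constructor
    · rintro ⟨n, r, hr, -⟩; exact ⟨r, hr⟩
    · rintro ⟨r, hr⟩
      obtain ⟨n, hn⟩ := exists_nat_ge r
      exact ⟨n, r, hr, hn⟩
  have hBm : ∀ c, MeasurableSet (B c) := fun c => isClosed_closure.measurableSet
  have hDm : MeasurableSet D := MeasurableSet.iUnion fun n => hBm n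
  have hem : Measurable e := by
    refine measurable_of_Iic fun c => ?_
    have : e ⁻¹' Set.Iic c = (B c) ∪ (Dᶜ ∩ {_x | 0 ≤ c}) := by
      ext x
      simp only [Set.mem_preimage, Set.mem_Iic, Set.mem_union, hB, Set.mem_inter_iff,
        Set.mem_compl_iff, hD, Set.mem_ofPred_eq]
      by_cases hx : (A x).Nonempty
      · simp only [hx, not_true, false_and, or_false]
        constructor
        · intro h; exact ⟨_, heA x hx, h⟩
        · rintro ⟨r, hr, hrc⟩; exact (csInf_le (hAbdd x) hr).trans hrc
      · have h0 : A x = ∅ := Set.not_nonempty_iff_eq_empty.1 hx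
        simp [h0, e]
    rw [this]
    exact (hBm c).union (hDm.compl.inter (MeasurableSet.const _))
  refine ⟨C, ψ, e, hCc, hψc, hψm, hem, ?_⟩
  have hKD : (⋃ n, K n) ⊆ D := by
    intro x hx
    obtain ⟨n, hn⟩ := Set.mem_iUnion.1 hx
    obtain ⟨b, hb⟩ := hfs n hn
    rw [hD]
    let r := cantorSetHomeomorphNatToBool.symm b
    have hr : (r : ℝ) + 2 * n ∈ Cn n := by
      simp [Cn]
    refine ⟨r + 2 * n, Set.mem_iUnion.2 ⟨n, hr⟩, ?_⟩
    simp only [Set.mem_preimage]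
    rw [hψ n _ hr]
    have : (⟨(r : ℝ) + 2 * n - 2 * n, hr⟩ : cantorSet) = r := Subtype.ext (by simp)
    rw [this]
    simp only [r, Homeomorph.apply_symm_apply, hb]
    exact subset_closure rfl
  have hD1 : μ D = 1 := le_antisymm prob_le_one (hK1 ▸ measure_mono hKD)
  have : ∀ᵐ x ∂μ, x ∈ D := (mem_ae_iff_prob_eq_one hDm).2 hD1
  filter_upwards [this] with x hx
  have := heA x ((hD x).1 hx)
  exact ⟨this.1, (hins _ _).1 this.2⟩

def qf (lam : Measure ℝ) (u : ℝ) : ℝ :=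
  open Classical in
  if u ∈ Set.Ioo (0:ℝ) 1 then sInf {r | u ≤ ProbabilityTheory.cdf lam r} else 0

abbrev LL : Measure ℝ := volume.restrict (Set.Ico (0:ℝ) 1)

instance LLprob : IsProbabilityMeasure LL := ⟨by simp [LL]⟩

lemma LL_Ioo : LL = volume.restrict (Set.Ioo (0:ℝ) 1) :=
  Measure.restrict_congr_set Ioo_ae_eq_Ico.symm

lemma LL_ae_Ioo : ∀ᵐ u ∂LL, u ∈ Set.Ioo (0:ℝ) 1 := by
  rw [LL_Ioo]; exact ae_restrict_mem measurableSet_Ioo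

lemma qf_le_iff (lam : Measure ℝ) {u : ℝ} (hu : u ∈ Set.Ioo (0:ℝ) 1) (r : ℝ) :
    qf lam u ≤ r ↔ u ≤ ProbabilityTheory.cdf lam r := by
  set F := ProbabilityTheory.cdf lam with hF
  have hbdd : BddBelow {r | u ≤ F r} := by
    have h0 := ProbabilityTheory.tendsto_cdf_atBot lam
    obtain ⟨r0, hr0⟩ := (h0.eventually (gt_mem_nhds hu.1)).exists
    refine ⟨r0, fun r hr => ?_⟩
    by_contra hlt
    push Not at hlt
    exact absurd (lt_of_le_of_lt (hr.trans (F.mono hlt.le)) hr0) (lt_irrefl _)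
  have hne : {r | u ≤ F r}.Nonempty := by
    have h0 := ProbabilityTheory.tendsto_cdf_atTop lam
    obtain ⟨r0, hr0⟩ := (h0.eventually (lt_mem_nhds hu.2)).exists
    exact ⟨r0, hr0.le⟩
  have hq : qf lam u = sInf {r | u ≤ F r} := by simp only [qf, hu, if_true, hF]
  rw [hq]
  constructor
  · intro h
    -- right continuity
    have hall : ∀ s, r < s → u ≤ F s := by
      intro s hs
      obtain ⟨w, hw, hws⟩ := exists_lt_of_csInf_lt hne (lt_of_le_of_lt h hs)
      exact le_trans hw (F.mono hws.le)
    have hc : Tendsto F (𝓝[>] r) (𝓝 (F r)) :=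
      ((F.right_continuous r).mono Set.Ioi_subset_Ici_self)
    refine ge_of_tendsto hc ?_
    filter_upwards [self_mem_nhdsWithin] with s hs using hall s hs
  · intro h
    exact csInf_le hbdd h

lemma qf_measurable (lam : Measure ℝ) : Measurable (qf lam) := by
  refine measurable_of_Iic fun r => ?_
  have : qf lam ⁻¹' Set.Iic r =
      (Set.Ioo (0:ℝ) 1 ∩ Set.Iic (ProbabilityTheory.cdf lam r)) ∪
        ((Set.Ioo (0:ℝ) 1)ᶜ ∩ {_x | 0 ≤ r}) := by
    ext u
    by_cases hu : u ∈ Set.Ioo (0:ℝ) 1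
    · have := qf_le_iff lam hu r
      simp only [Set.mem_preimage, Set.mem_Iic, Set.mem_union, Set.mem_inter_iff, hu, true_and,
        Set.mem_compl_iff, not_true, false_and, or_false]
      exact this
    · have : qf lam u = 0 := by simp only [qf, hu, if_false]
      simp only [Set.mem_preimage, Set.mem_Iic, Set.mem_union, Set.mem_inter_iff, hu, false_and,
        Set.mem_compl_iff, not_false_iff, true_and, false_or, this, Set.mem_ofPred_eq]
  rw [this]
  exact (measurableSet_Ioo.inter measurableSet_Iic).union
    (measurableSet_Ioo.compl.inter (MeasurableSet.const _))

lemma qf_map (lam : Measure ℝ) [IsProbabilityMeasure lam] : LL.map (qf lam) = lam := by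
  have : IsProbabilityMeasure (LL.map (qf lam)) :=
    Measure.isProbabilityMeasure_map (qf_measurable lam).aemeasurable
  refine Measure.ext_of_Iic _ _ fun r => ?_
  rw [Measure.map_apply (qf_measurable lam) measurableSet_Iic, LL_Ioo,
    Measure.restrict_apply ((qf_measurable lam) measurableSet_Iic)]
  have hF1 := ProbabilityTheory.cdf_le_one lam r
  have hF0 := ProbabilityTheory.cdf_nonneg lam r
  have h1 : qf lam ⁻¹' Set.Iic r ∩ Set.Ioo 0 1 =
      Set.Ioo (0:ℝ) 1 ∩ Set.Iic (ProbabilityTheory.cdf lam r) := by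
    ext u
    simp only [Set.mem_inter_iff, Set.mem_preimage, Set.mem_Iic]
    constructor
    · rintro ⟨a, b⟩; exact ⟨b, (qf_le_iff lam b r).1 a⟩
    · rintro ⟨b, a⟩; exact ⟨(qf_le_iff lam b r).2 a, b⟩
  rw [h1]
  have h2 : (Set.Ioo (0:ℝ) 1 ∩ Set.Iic (ProbabilityTheory.cdf lam r) : Set ℝ) =ᵐ[volume]
      (Set.Ioc (0:ℝ) 1 ∩ Set.Iic (ProbabilityTheory.cdf lam r) : Set ℝ) :=
    Ioo_ae_eq_Ioc.inter (ae_eq_refl _)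
  rw [measure_congr h2, Set.Ioc_inter_Iic, Real.volume_Ioc, inf_eq_right.2 hF1, sub_zero,
    ProbabilityTheory.cdf_eq_real, ofReal_measureReal]

lemma qf_mono (lam : Measure ℝ) : MonotoneOn (qf lam) (Set.Ioo 0 1) := by
  intro u hu v hv huv
  rw [qf_le_iff lam hu]
  exact huv.trans ((qf_le_iff lam hv _).1 le_rfl)

lemma qf_mem (lam : Measure ℝ) [IsProbabilityMeasure lam] {C : Set ℝ} (hC : IsClosed C)
    (h1 : ∀ᵐ r ∂lam, r ∈ C) {u : ℝ} (hu : u ∈ Set.Ioo (0:ℝ) 1) : qf lam u ∈ C := by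
  by_contra hn
  obtain ⟨d, hd, hball⟩ := Metric.isOpen_iff.1 hC.isOpen_compl _ hn
  set x := qf lam u with hx
  have h0 : lam (Set.Ioc (x - d / 2) x) = 0 := by
    refine measure_mono_null (fun r hr => ?_) h1
    refine hball ?_
    rw [Metric.mem_ball, Real.dist_eq, abs_lt]
    constructor <;> linarith [hr.1, hr.2]
  have hle : u ≤ ProbabilityTheory.cdf lam (x - d / 2) := by
    refine ((qf_le_iff lam hu x).1 le_rfl).trans ?_
    rw [ProbabilityTheory.cdf_eq_real, ProbabilityTheory.cdf_eq_real]
    refine ENNReal.toReal_mono (measure_ne_top _ _) ?_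
    rw [← Set.Iic_union_Ioc_eq_Iic (show x - d / 2 ≤ x by linarith)]
    exact (measure_union_le _ _).trans (by rw [h0, add_zero])
  have := (qf_le_iff lam hu _).2 hle
  linarith

lemma qf_cdf (lam : Measure ℝ) [IsProbabilityMeasure lam] [NullSingletonClass lam]
    {u : ℝ} (hu : u ∈ Set.Ioo (0:ℝ) 1) : ProbabilityTheory.cdf lam (qf lam u) = u := by
  refine le_antisymm ?_ ((qf_le_iff lam hu _).1 le_rfl)
  set x := qf lam u
  set F := ProbabilityTheory.cdf lam with hF
  have hlt : ∀ r < x, F r ≤ u := fun r hr => by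
    by_contra h
    push Not at h
    exact absurd ((qf_le_iff lam hu r).2 h.le) (not_le.2 hr)
  have h1 : lam (Set.Iio x) ≤ ENNReal.ofReal u := by
    obtain ⟨s, hs, hsx, hst⟩ := exists_seq_strictMono_tendsto x
    have hun : Set.Iio x = ⋃ n, Set.Iic (s n) := by
      ext y
      simp only [Set.mem_Iio, Set.mem_iUnion, Set.mem_Iic]
      constructor
      · intro hy
        obtain ⟨n, hn⟩ := (hst.eventually (lt_mem_nhds hy)).exists
        exact ⟨n, hn.le⟩
      · rintro ⟨n, hn⟩; exact lt_of_le_of_lt hn (hsx n)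
    rw [hun]
    have hmono : Monotone fun n => Set.Iic (s n) := fun a b hab =>
      Set.Iic_subset_Iic.2 (hs.monotone hab)
    rw [hmono.measure_iUnion]
    refine iSup_le fun n => ?_
    rw [← ProbabilityTheory.ofReal_cdf lam]
    exact ENNReal.ofReal_le_ofReal (hlt _ (hsx n))
  rw [hF, ProbabilityTheory.cdf_eq_real, measureReal_def, measure_congr Iio_ae_eq_Iic.symm]
  exact ENNReal.toReal_le_of_le_ofReal hu.1.le h1

def cellMap (δ : ℝ) (p : ℝ × ℝ) : ℤ × ℤ := (⌊p.1 / δ⌋, ⌊p.2 / δ⌋)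

lemma cellMap_measurable (δ : ℝ) : Measurable (cellMap δ) := by
  unfold cellMap
  exact (Int.measurable_floor.comp (measurable_fst.div_const δ)).prodMk
    (Int.measurable_floor.comp (measurable_snd.div_const δ))

lemma coupling_prob {π : Measure (ℝ × ℝ)} (hπ : IsCoupling π LL LL) : IsProbabilityMeasure π := by
  constructor
  have : (π.map Prod.fst) Set.univ = 1 := by rw [hπ.1]; exact measure_univ
  rwa [Measure.map_apply measurable_fst MeasurableSet.univ] at this

lemma floor_close {δ u v : ℝ} (hδ : 0 < δ) (h : ⌊u / δ⌋ = ⌊v / δ⌋) : |u - v| < δ := by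
  have h1 := Int.abs_sub_lt_one_of_floor_eq_floor h
  rw [← sub_div, abs_div, abs_of_pos hδ, div_lt_one hδ] at h1
  exact h1

lemma compact_part {G : Set ℝ} (hG : MeasurableSet G) (hG' : ∀ᵐ u ∂LL, u ∈ G) {η : ℝ}
    (hη : 0 < η) : ∃ P ⊆ G, IsCompact P ∧ LL Pᶜ ≤ ENNReal.ofReal η := by
  obtain ⟨P, hPG, hPc, hP⟩ := hG.exists_isCompact_lt_add (μ := LL) (measure_ne_top _ _)
    (ε := ENNReal.ofReal η) (by simpa using hη)
  refine ⟨P, hPG, hPc, ?_⟩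
  have h1 : LL G = 1 := (mem_ae_iff_prob_eq_one hG).1 hG'
  rw [prob_compl_eq_one_sub hPc.measurableSet, ← h1]
  exact tsub_le_iff_left.2 hP.le

lemma ofReal_le_trunc (x R : ℝ) :
    ENNReal.ofReal x ≤ ENNReal.ofReal R + (if R ≤ x then ENNReal.ofReal x else 0) := by
  split_ifs with h
  · exact le_add_self
  · rw [add_zero]; exact ENNReal.ofReal_le_ofReal (le_of_not_ge h)

lemma lemmaA {T : Type*} [MetricSpace T] (H : ℝ → ℝ → T → ℝ) (G1 G2 : Set ℝ)
    (hG1 : MeasurableSet G1) (hG2 : MeasurableSet G2)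
    (hG1' : ∀ᵐ u ∂LL, u ∈ G1) (hG2' : ∀ᵐ u ∂LL, u ∈ G2)
    (hc : ∀ u ∈ G1, ∀ v ∈ G2, ∀ t, ContinuousAt (fun p : ℝ × ℝ × T => H p.1 p.2.1 p.2.2) (u, v, t))
    (α β : T → ℝ → ℝ) (hα : ∀ t, Measurable (α t)) (hβ : ∀ t, Measurable (β t))
    (hdom : ∀ t u v, H u v t ≤ α t u + β t v)
    (hUI : ∀ ε > (0:ℝ), ∃ R : ℝ, 0 ≤ R ∧ ∀ t,
      (∫⁻ u, (if R ≤ α t u then ENNReal.ofReal (α t u) else 0) ∂LL ≤ ENNReal.ofReal ε) ∧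
      (∫⁻ u, (if R ≤ β t u then ENNReal.ofReal (β t u) else 0) ∂LL ≤ ENNReal.ofReal ε))
    (t0 : T) {ε : ℝ} (hε : 0 < ε) :
    ∃ δ0 > 0, ∀ t ∈ Metric.ball t0 δ0, ∀ t' ∈ Metric.ball t0 δ0, ∀ δ, 0 < δ → δ ≤ δ0 →
      ∀ π π' : Measure (ℝ × ℝ), IsCoupling π LL LL → IsCoupling π' LL LL →
        π.map (cellMap δ) = π'.map (cellMap δ) →
        ∫⁻ p, ENNReal.ofReal (H p.1 p.2 t) ∂π ≤
          ∫⁻ p, ENNReal.ofReal (H p.1 p.2 t') ∂π' + ENNReal.ofReal ε := by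
  classical
  obtain ⟨R, hR0, hR⟩ := hUI (ε / 12) (by positivity)
  set η : ℝ := ε / (24 * (R + 1)) with hη
  have hηpos : 0 < η := by positivity
  have hRη : 2 * R * (2 * η) ≤ ε / 6 := by
    rw [hη]
    have : 2 * R * (2 * (ε / (24 * (R + 1)))) = (ε / 6) * (R / (R + 1)) := by field_simp; ring
    rw [this]
    have h2 : R / (R + 1) ≤ 1 := by rw [div_le_one (by positivity)]; linarith
    nlinarith
  obtain ⟨P1, hP1G, hP1c, hP1⟩ := compact_part hG1 hG1' hηpos
  obtain ⟨P2, hP2G, hP2c, hP2⟩ := compact_part hG2 hG2' hηpos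
  have hK : IsCompact (P1 ×ˢ (P2 ×ˢ ({t0} : Set T))) := hP1c.prod (hP2c.prod isCompact_singleton)
  have hu := hK.uniformContinuousAt_of_continuousAt (fun p : ℝ × ℝ × T => H p.1 p.2.1 p.2.2)
    (by
      rintro ⟨u, v, t⟩ ⟨h1, h2, h3⟩
      exact hc u (hP1G h1) v (hP2G h2) t)
    (Metric.dist_mem_uniformity (show 0 < ε / 6 by positivity))
  obtain ⟨δ0, hδ0, hδ⟩ := Metric.mem_uniformity_dist.1 hu
  have key : ∀ u ∈ P1, ∀ v ∈ P2, ∀ u' v' t, |u' - u| < δ0 → |v' - v| < δ0 → t ∈ Metric.ball t0 δ0 →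
      |H u v t0 - H u' v' t| < ε / 6 := by
    intro u hu v hv u' v' t h1 h2 h3
    have hd : dist ((u, v, t0) : ℝ × ℝ × T) (u', v', t) < δ0 := by
      rw [Prod.dist_eq, Prod.dist_eq, max_lt_iff, max_lt_iff, Real.dist_eq, Real.dist_eq,
        abs_sub_comm u, abs_sub_comm v]
      exact ⟨h1, h2, by rw [dist_comm]; exact h3⟩
    have := hδ hd ⟨hu, hv, rfl⟩
    simpa [Real.dist_eq] using this
  refine ⟨δ0, hδ0, ?_⟩
  intro t ht t' ht' δ hδp hδle π π' hπ hπ' hcell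
  have := coupling_prob hπ
  have := coupling_prob hπ'
  let good : ℤ × ℤ → Prop := fun k => ∃ w : ℝ × ℝ, w.1 ∈ P1 ∧ w.2 ∈ P2 ∧ cellMap δ w = k
  let g : ℤ × ℤ → ENNReal := fun k =>
    if hk : good k then ENNReal.ofReal (H hk.choose.1 hk.choose.2 t0 - ε / 6) else 0
  have hgood : ∀ p (hk : good (cellMap δ p)) s, s ∈ Metric.ball t0 δ0 →
      |H hk.choose.1 hk.choose.2 t0 - H p.1 p.2 s| < ε / 6 := by
    intro p hk s hs
    obtain ⟨h1, h2, h3⟩ := hk.choose_spec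
    have e1 := congrArg Prod.fst h3
    have e2 := congrArg Prod.snd h3
    exact key _ h1 _ h2 _ _ s ((floor_close hδp e1.symm).trans_le hδle)
      ((floor_close hδp e2.symm).trans_le hδle) hs
  have hlow : ∀ p : ℝ × ℝ, g (cellMap δ p) ≤ ENNReal.ofReal (H p.1 p.2 t') := by
    intro p
    by_cases hk : good (cellMap δ p)
    · simp only [g, hk, dif_pos]
      have := abs_lt.1 (hgood p hk t' ht')
      exact ENNReal.ofReal_le_ofReal (by linarith [this.2])
    · simp only [g, hk, dif_neg, not_false_iff]; exact zero_le
  let B : Set (ℝ × ℝ) := Prod.fst ⁻¹' P1ᶜ ∪ Prod.snd ⁻¹' P2ᶜ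
  have hBm : MeasurableSet B := (measurable_fst hP1c.measurableSet.compl).union
    (measurable_snd hP2c.measurableSet.compl)
  have hup : ∀ p : ℝ × ℝ, ENNReal.ofReal (H p.1 p.2 t) ≤
      g (cellMap δ p) + (ENNReal.ofReal (ε / 3) + (B.indicator (fun _ => ENNReal.ofReal (2 * R)) p +
        ((if R ≤ α t p.1 then ENNReal.ofReal (α t p.1) else 0) +
          (if R ≤ β t p.2 then ENNReal.ofReal (β t p.2) else 0)))) := by
    intro p
    by_cases hk : good (cellMap δ p)
    · have := abs_lt.1 (hgood p hk t ht)
      refine le_trans ?_ (add_le_add le_rfl (le_self_add))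
      simp only [g, hk, dif_pos]
      refine le_trans ?_ ENNReal.ofReal_add_le
      exact ENNReal.ofReal_le_ofReal (by linarith [this.1])
    · have hpB : p ∈ B := by
        by_contra hpB
        simp only [B, Set.mem_union, Set.mem_preimage, Set.mem_compl_iff, not_or, not_not] at hpB
        exact hk ⟨p, hpB.1, hpB.2, rfl⟩
      refine le_trans ?_ le_add_self
      refine le_trans ?_ le_add_self
      rw [Set.indicator_of_mem hpB]
      refine (ENNReal.ofReal_le_ofReal (hdom t p.1 p.2)).trans (ENNReal.ofReal_add_le.trans ?_)
      refine (add_le_add (ofReal_le_trunc _ R) (ofReal_le_trunc _ R)).trans ?_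
      rw [two_mul, ENNReal.ofReal_add hR0 hR0]
      exact le_of_eq (by ring)
  have hgm : Measurable g := measurable_of_countable g
  have hi1 : ∫⁻ p, g (cellMap δ p) ∂π ≤ ∫⁻ p, ENNReal.ofReal (H p.1 p.2 t') ∂π' := by
    rw [← lintegral_map hgm (cellMap_measurable δ), hcell, lintegral_map hgm (cellMap_measurable δ)]
    exact lintegral_mono hlow
  have hαm : Measurable fun u => (if R ≤ α t u then ENNReal.ofReal (α t u) else 0) :=
    Measurable.ite (measurableSet_le measurable_const (hα t)) (hα t).ennreal_ofReal measurable_const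
  have hβm : Measurable fun u => (if R ≤ β t u then ENNReal.ofReal (β t u) else 0) :=
    Measurable.ite (measurableSet_le measurable_const (hβ t)) (hβ t).ennreal_ofReal measurable_const
  have hi2 : ∫⁻ p : ℝ × ℝ, (if R ≤ α t p.1 then ENNReal.ofReal (α t p.1) else 0) ∂π
      ≤ ENNReal.ofReal (ε / 12) := by
    rw [← lintegral_map hαm measurable_fst, hπ.1]
    exact (hR t).1
  have hi3 : ∫⁻ p : ℝ × ℝ, (if R ≤ β t p.2 then ENNReal.ofReal (β t p.2) else 0) ∂π
      ≤ ENNReal.ofReal (ε / 12) := by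
    rw [← lintegral_map hβm measurable_snd, hπ.2]
    exact (hR t).2
  have hB : π B ≤ ENNReal.ofReal (2 * η) := by
    refine (measure_union_le _ _).trans ?_
    rw [← Measure.map_apply measurable_fst hP1c.measurableSet.compl,
      ← Measure.map_apply measurable_snd hP2c.measurableSet.compl, hπ.1, hπ.2, two_mul,
      ENNReal.ofReal_add hηpos.le hηpos.le]
    exact add_le_add hP1 hP2
  have hi4 : ∫⁻ p, B.indicator (fun _ => ENNReal.ofReal (2 * R)) p ∂π ≤ ENNReal.ofReal (ε / 6) := by
    rw [lintegral_indicator_const hBm]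
    refine (mul_le_mul_right hB _).trans ?_
    rw [← ENNReal.ofReal_mul (by positivity)]
    exact ENNReal.ofReal_le_ofReal hRη
  refine (lintegral_mono hup).trans ?_
  have hm1 : Measurable fun p => g (cellMap δ p) := hgm.comp (cellMap_measurable δ)
  have hm2 : Measurable fun p : ℝ × ℝ => (if R ≤ α t p.1 then ENNReal.ofReal (α t p.1) else 0) :=
    hαm.comp measurable_fst
  rw [lintegral_add_left hm1, lintegral_add_left measurable_const,
    lintegral_add_left (measurable_const.indicator hBm),
    lintegral_add_left hm2, lintegral_const, measure_univ, mul_one]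
  refine (add_le_add hi1 (add_le_add le_rfl (add_le_add hi4 (add_le_add hi2 hi3)))).trans ?_
  gcongr
  rw [← ENNReal.ofReal_add (by positivity) (by positivity),
    ← ENNReal.ofReal_add (by positivity) (by positivity),
    ← ENNReal.ofReal_add (by positivity) (by positivity)]
  exact ENNReal.ofReal_le_ofReal (by linarith)

def rearr {ι : Type*} (x y c : ι → ℝ) (u : ℝ) : ℝ :=
  open Classical in
  if h : ∃ i, u ∈ Set.Ico (x i) (x i + c i) then u + (y h.choose - x h.choose) else u

def Tiles {ι : Type*} (x c : ι → ℝ) : Prop :=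
  Pairwise (fun i j => Disjoint (Set.Ico (x i) (x i + c i)) (Set.Ico (x j) (x j + c j))) ∧
    ⋃ i, Set.Ico (x i) (x i + c i) = Set.Ico (0:ℝ) 1

lemma rearr_eq {ι : Type*} {x y c : ι → ℝ} (hx : Tiles x c) {i : ι} {u : ℝ}
    (hu : u ∈ Set.Ico (x i) (x i + c i)) : rearr x y c u = u + (y i - x i) := by
  have h : ∃ i, u ∈ Set.Ico (x i) (x i + c i) := ⟨i, hu⟩
  have hi : h.choose = i := by
    by_contra hne
    exact Set.disjoint_left.1 (hx.1 hne) h.choose_spec hu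
  simp only [rearr, h, dif_pos, hi]

lemma rearr_pre {ι : Type*} {x y c : ι → ℝ} (hx : Tiles x c) (B : Set ℝ) (i : ι) :
    rearr x y c ⁻¹' B ∩ Set.Ico (x i) (x i + c i) =
      (fun u => u + (y i - x i)) ⁻¹' (B ∩ Set.Ico (y i) (y i + c i)) := by
  ext u
  simp only [Set.mem_inter_iff, Set.mem_preimage]
  constructor
  · rintro ⟨h1, h2⟩
    rw [rearr_eq hx h2] at h1
    exact ⟨h1, by linarith [h2.1], by linarith [h2.2]⟩
  · rintro ⟨h1, h2⟩
    have h3 : u ∈ Set.Ico (x i) (x i + c i) := ⟨by linarith [h2.1], by linarith [h2.2]⟩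
    rw [rearr_eq hx h3]
    exact ⟨h1, h3⟩

lemma rearr_measurable {ι : Type*} [Countable ι] {x y c : ι → ℝ} (hx : Tiles x c) :
    Measurable (rearr x y c) := by
  intro B hB
  have : rearr x y c ⁻¹' B = (⋃ i, (fun u => u + (y i - x i)) ⁻¹' (B ∩ Set.Ico (y i) (y i + c i)))
      ∪ (B ∩ (Set.Ico (0:ℝ) 1)ᶜ) := by
    simp_rw [← rearr_pre hx B]
    rw [← Set.inter_iUnion, hx.2]
    ext u
    by_cases hu : u ∈ Set.Ico (0:ℝ) 1
    · simp [hu]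
    · have hn : ¬ ∃ i, u ∈ Set.Ico (x i) (x i + c i) := by
        rw [← Set.mem_iUnion, hx.2]; exact hu
      have : rearr x y c u = u := by simp only [rearr, hn, dif_neg, not_false_iff]
      simp only [Set.mem_preimage, this, Set.mem_union, Set.mem_inter_iff, hu, and_false, false_or,
        Set.mem_compl_iff, not_false_iff, and_true]
  rw [this]
  refine (MeasurableSet.iUnion fun i => ?_).union (hB.inter measurableSet_Ico.compl)
  exact (measurable_add_const _) (hB.inter measurableSet_Ico)

lemma rearr_map {ι : Type*} [Countable ι] {x y c : ι → ℝ} (hx : Tiles x c) (hy : Tiles y c) :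
    LL.map (rearr x y c) = LL := by
  ext B hB
  rw [Measure.map_apply (rearr_measurable hx) hB, Measure.restrict_apply (rearr_measurable hx hB),
    Measure.restrict_apply hB]
  conv_lhs => rw [← hx.2]
  conv_rhs => rw [← hy.2]
  rw [Set.inter_iUnion, Set.inter_iUnion, measure_iUnion, measure_iUnion]
  · refine tsum_congr fun i => ?_
    rw [rearr_pre hx, measure_preimage_add_right]
  · intro i j hij
    exact (hy.1 hij).mono Set.inter_subset_right Set.inter_subset_right
  · exact fun i => hB.inter measurableSet_Ico
  · intro i j hij
    exact (hx.1 hij).mono Set.inter_subset_right Set.inter_subset_right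
  · exact fun i => (rearr_measurable hx hB).inter measurableSet_Ico

lemma iUnion_Ico_mono {f : ℕ → ℝ} (hf : Monotone f) {b : ℝ} (hb : ∀ n, f n ≤ b)
    (hN : ∃ N, f N = b) : ⋃ n, Set.Ico (f n) (f (n + 1)) = Set.Ico (f 0) b := by
  ext u
  simp only [Set.mem_iUnion, Set.mem_Ico]
  constructor
  · rintro ⟨n, h1, h2⟩
    exact ⟨(hf (Nat.zero_le n)).trans h1, h2.trans_le (hb _)⟩
  · rintro ⟨h1, h2⟩
    classical
    obtain ⟨N, hN⟩ := hN
    have hex : ∃ n, u < f n := ⟨N, hN ▸ h2⟩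
    have hs := Nat.find_spec hex
    have hm := fun m => Nat.find_min hex (m := m)
    obtain ⟨m, hm'⟩ : ∃ m, Nat.find hex = m + 1 := by
      refine Nat.exists_eq_succ_of_ne_zero fun h0 => ?_
      rw [h0] at hs
      linarith
    rw [hm'] at hs
    exact ⟨m, le_of_not_gt (hm m (by omega)), hs⟩

def aa (δ : ℝ) (k : ℕ) : ℝ := min (k * δ) 1

structure IsCop (F : ℝ → ℝ → ℝ) : Prop where
  zr : ∀ a, F a 0 = 0
  zl : ∀ b, F 0 b = 0
  or : ∀ a, 0 ≤ a → a ≤ 1 → F a 1 = a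
  ol : ∀ b, 0 ≤ b → b ≤ 1 → F 1 b = b
  inc : ∀ a a' b b', a ≤ a' → b ≤ b' → 0 ≤ F a' b' - F a b' - F a' b + F a b
  lip : ∀ a a' b b', |F a b - F a' b'| ≤ |a - a'| + |b - b'|

lemma IsCop.flip {F : ℝ → ℝ → ℝ} (h : IsCop F) : IsCop (fun a b => F b a) where
  zr := h.zl
  zl := h.zr
  or := h.ol
  ol := h.or
  inc a a' b b' h1 h2 := by linarith [h.inc b b' a a' h2 h1]
  lip a a' b b' := by rw [add_comm]; exact h.lip b b' a a'

def xx (F : ℝ → ℝ → ℝ) (δ : ℝ) (i : ℕ × ℕ) : ℝ :=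
  aa δ i.1 + F (aa δ (i.1 + 1)) (aa δ i.2) - F (aa δ i.1) (aa δ i.2)
def yy (F : ℝ → ℝ → ℝ) (δ : ℝ) (i : ℕ × ℕ) : ℝ :=
  aa δ i.2 + F (aa δ i.1) (aa δ (i.2 + 1)) - F (aa δ i.1) (aa δ i.2)
def cc (F : ℝ → ℝ → ℝ) (δ : ℝ) (i : ℕ × ℕ) : ℝ :=
  F (aa δ (i.1 + 1)) (aa δ (i.2 + 1)) - F (aa δ i.1) (aa δ (i.2 + 1))
    - F (aa δ (i.1 + 1)) (aa δ i.2) + F (aa δ i.1) (aa δ i.2)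

lemma aa_mono {δ : ℝ} (hδ : 0 < δ) : Monotone (aa δ) := by
  intro k l hkl
  have : (k : ℝ) ≤ l := by exact_mod_cast hkl
  exact min_le_min_right _ (by nlinarith)

lemma aa_zero (δ : ℝ) : aa δ 0 = 0 := by simp [aa]

lemma aa_nonneg {δ : ℝ} (hδ : 0 < δ) (k : ℕ) : 0 ≤ aa δ k :=
  le_min (by positivity) zero_le_one

lemma aa_le_one (δ : ℝ) (k : ℕ) : aa δ k ≤ 1 := min_le_right _ _

lemma aa_one {δ : ℝ} (hδ : 0 < δ) : ∃ N, aa δ N = 1 := by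
  obtain ⟨N, hN⟩ := exists_nat_ge (1 / δ)
  refine ⟨N, min_eq_right ?_⟩
  rwa [div_le_iff₀ hδ] at hN

lemma row_union {F : ℝ → ℝ → ℝ} (hF : IsCop F) {δ : ℝ} (hδ : 0 < δ) (k : ℕ) :
    Monotone (fun l => xx F δ (k, l)) ∧
    ⋃ l, Set.Ico (xx F δ (k, l)) (xx F δ (k, l) + cc F δ (k, l)) =
      Set.Ico (aa δ k) (aa δ (k + 1)) := by
  have hk1 : aa δ k ≤ aa δ (k + 1) := aa_mono hδ (Nat.le_succ k)
  have hm : Monotone (fun l => xx F δ (k, l)) := by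
    intro l l' hl
    simp only [xx]
    have := hF.inc _ _ _ _ hk1 (aa_mono hδ hl)
    linarith
  refine ⟨hm, ?_⟩
  have hs : ∀ l, xx F δ (k, l) + cc F δ (k, l) = xx F δ (k, l + 1) := by
    intro l; simp only [xx, cc]; ring
  simp_rw [hs]
  have hone : ∀ l, aa δ l = 1 → xx F δ (k, l) = aa δ (k + 1) := by
    intro l hl
    simp only [xx]
    rw [hl, hF.or _ (aa_nonneg hδ _) (aa_le_one _ _), hF.or _ (aa_nonneg hδ _) (aa_le_one _ _)]
    ring
  obtain ⟨N, hN⟩ := aa_one hδ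
  have h0 : xx F δ (k, 0) = aa δ k := by simp [xx, aa_zero, hF.zr]
  rw [iUnion_Ico_mono hm (b := aa δ (k + 1)) ?_ ⟨N, hone N hN⟩]
  · simp [h0]
  · intro n
    have h1 : aa δ (max n N) = 1 :=
      le_antisymm (aa_le_one _ _) (hN ▸ aa_mono hδ (le_max_right _ _))
    rw [← hone _ h1]
    exact hm (le_max_left _ _)

lemma E_union {δ : ℝ} (hδ : 0 < δ) :
    ⋃ k, Set.Ico (aa δ k) (aa δ (k + 1)) = Set.Ico 0 1 := by
  rw [iUnion_Ico_mono (aa_mono hδ) (aa_le_one δ) (aa_one hδ), aa_zero]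

lemma E_disj {δ : ℝ} (hδ : 0 < δ) {k k' : ℕ} (h : k ≠ k') :
    Disjoint (Set.Ico (aa δ k) (aa δ (k + 1))) (Set.Ico (aa δ k') (aa δ (k' + 1))) :=
  (aa_mono hδ).pairwise_disjoint_on_Ico_succ h

lemma X_sub {F : ℝ → ℝ → ℝ} (hF : IsCop F) {δ : ℝ} (hδ : 0 < δ) (i : ℕ × ℕ) :
    Set.Ico (xx F δ i) (xx F δ i + cc F δ i) ⊆ Set.Ico (aa δ i.1) (aa δ (i.1 + 1)) := by
  rw [← (row_union hF hδ i.1).2]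
  exact Set.subset_iUnion (fun l => Set.Ico (xx F δ (i.1, l)) (xx F δ (i.1, l) + cc F δ (i.1, l))) i.2

lemma tiles_x {F : ℝ → ℝ → ℝ} (hF : IsCop F) {δ : ℝ} (hδ : 0 < δ) :
    Tiles (xx F δ) (cc F δ) := by
  constructor
  · rintro ⟨k, l⟩ ⟨k', l'⟩ hne
    by_cases hk : k = k'
    · subst hk
      have hl : l ≠ l' := fun h => hne (by rw [h])
      have := (row_union hF hδ k).1.pairwise_disjoint_on_Ico_succ hl
      have hs : ∀ l, xx F δ (k, l) + cc F δ (k, l) = xx F δ (k, l + 1) := by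
        intro l; simp only [xx, cc]; ring
      simp only [hs]
      exact this
    · exact (E_disj hδ hk).mono (X_sub hF hδ (k, l)) (X_sub hF hδ (k', l'))
  · rw [Set.iUnion_prod']
    simp_rw [(row_union hF hδ _).2]
    exact E_union hδ

lemma tiles_y {F : ℝ → ℝ → ℝ} (hF : IsCop F) {δ : ℝ} (hδ : 0 < δ) :
    Tiles (yy F δ) (cc F δ) := by
  have h := tiles_x hF.flip hδ
  have hx : ∀ i, yy F δ i = xx (fun a b => F b a) δ i.swap := fun i => rfl
  have hc : ∀ i, cc F δ i = cc (fun a b => F b a) δ i.swap := fun i => by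
    simp only [cc, Prod.fst_swap, Prod.snd_swap]; ring
  constructor
  · intro i j hij
    simp only [hx, hc]
    exact h.1 (fun h' => hij (Prod.swap_injective h'))
  · rw [← h.2]
    simp only [hx, hc]
    exact Prod.swap_surjective.iUnion_comp
      (fun i => Set.Ico (xx (fun a b => F b a) δ i) (xx (fun a b => F b a) δ i + cc (fun a b => F b a) δ i))

lemma Y_sub {F : ℝ → ℝ → ℝ} (hF : IsCop F) {δ : ℝ} (hδ : 0 < δ) (i : ℕ × ℕ) :
    Set.Ico (yy F δ i) (yy F δ i + cc F δ i) ⊆ Set.Ico (aa δ i.2) (aa δ (i.2 + 1)) := by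
  have hc : cc F δ i = cc (fun a b => F b a) δ i.swap := by
    simp only [cc, Prod.fst_swap, Prod.snd_swap]; ring
  rw [hc]
  exact X_sub hF.flip hδ i.swap

/-- the Monge map attached to a copula and a mesh -/
def TT (F : ℝ → ℝ → ℝ) (δ : ℝ) : ℝ → ℝ := rearr (xx F δ) (yy F δ) (cc F δ)

lemma TT_cell {F : ℝ → ℝ → ℝ} (hF : IsCop F) {δ : ℝ} (hδ : 0 < δ) (k l : ℕ) :
    (LL.map (fun u => (u, TT F δ u)))
      (Set.Ico (aa δ k) (aa δ (k + 1)) ×ˢ Set.Ico (aa δ l) (aa δ (l + 1))) =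
      ENNReal.ofReal (cc F δ (k, l)) := by
  have hTm : Measurable (TT F δ) := rearr_measurable (tiles_x hF hδ)
  have hm : Measurable (fun u => (u, TT F δ u)) := measurable_id.prodMk hTm
  have hms := (measurableSet_Ico (a := aa δ k) (b := aa δ (k + 1))).prod
    (measurableSet_Ico (a := aa δ l) (b := aa δ (l + 1)))
  rw [Measure.map_apply hm hms, Measure.restrict_apply (hm hms)]
  have hmem : ∀ (i : ℕ × ℕ) u, u ∈ Set.Ico (xx F δ i) (xx F δ i + cc F δ i) →
      TT F δ u ∈ Set.Ico (aa δ i.2) (aa δ (i.2 + 1)) := by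
    intro i u hu
    apply Y_sub hF hδ i
    rw [TT, rearr_eq (tiles_x hF hδ) hu]
    exact ⟨by linarith [hu.1], by linarith [hu.2]⟩
  have : (fun u => (u, TT F δ u)) ⁻¹' (Set.Ico (aa δ k) (aa δ (k + 1)) ×ˢ
      Set.Ico (aa δ l) (aa δ (l + 1))) ∩ Set.Ico 0 1 =
      Set.Ico (xx F δ (k, l)) (xx F δ (k, l) + cc F δ (k, l)) := by
    ext u
    constructor
    · rintro ⟨⟨h1, h2⟩, h3⟩
      rw [← (tiles_x hF hδ).2] at h3
      obtain ⟨⟨k', l'⟩, hi⟩ := Set.mem_iUnion.1 h3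
      have e1 : k' = k := by
        by_contra hne
        exact Set.disjoint_left.1 (E_disj hδ hne) (X_sub hF hδ _ hi) h1
      have e2 : l' = l := by
        by_contra hne
        exact Set.disjoint_left.1 (E_disj hδ hne) (hmem _ _ hi) h2
      rwa [e1, e2] at hi
    · intro hu
      refine ⟨⟨X_sub hF hδ _ hu, hmem _ _ hu⟩, ?_⟩
      rw [← (tiles_x hF hδ).2]
      exact Set.mem_iUnion.2 ⟨_, hu⟩
  rw [this, Real.volume_Ico, add_sub_cancel_left]

lemma TT_coupling {F : ℝ → ℝ → ℝ} (hF : IsCop F) {δ : ℝ} (hδ : 0 < δ) :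
    Measurable (TT F δ) ∧ LL.map (TT F δ) = LL ∧
      IsCoupling (LL.map (fun u => (u, TT F δ u))) LL LL := by
  have hTm : Measurable (TT F δ) := rearr_measurable (tiles_x hF hδ)
  have hT : LL.map (TT F δ) = LL := rearr_map (tiles_x hF hδ) (tiles_y hF hδ)
  have hm : Measurable (fun u => (u, TT F δ u)) := measurable_id.prodMk hTm
  refine ⟨hTm, hT, ?_, ?_⟩
  · rw [Measure.map_map measurable_fst hm]
    exact Measure.map_id
  · rw [Measure.map_map measurable_snd hm]
    exact hT

lemma cell_iff {δ : ℝ} (hδ : 0 < δ) {u : ℝ} (hu : u ∈ Set.Ico (0:ℝ) 1) (k : ℕ) :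
    ⌊u / δ⌋ = (k : ℤ) ↔ u ∈ Set.Ico (aa δ k) (aa δ (k + 1)) := by
  rw [Int.floor_eq_iff, le_div_iff₀ hδ, div_lt_iff₀ hδ]
  simp only [aa, Set.mem_Ico, min_le_iff, lt_min_iff]
  push_cast
  constructor
  · rintro ⟨h1, h2⟩; exact ⟨Or.inl h1, h2, hu.2⟩
  · rintro ⟨h1, h2, -⟩
    exact ⟨h1.resolve_right (not_le.2 hu.2), h2⟩

lemma coupling_ae {π : Measure (ℝ × ℝ)} (hπ : IsCoupling π LL LL) {G1 G2 : Set ℝ}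
    (h1 : ∀ᵐ u ∂LL, u ∈ G1) (h2 : ∀ᵐ u ∂LL, u ∈ G2) :
    ∀ᵐ p ∂π, p.1 ∈ G1 ∧ p.2 ∈ G2 := by
  rw [← hπ.1] at h1
  rw [← hπ.2] at h2
  exact (ae_of_ae_map measurable_fst.aemeasurable h1).and
    (ae_of_ae_map measurable_snd.aemeasurable h2)

lemma LL_mem : ∀ᵐ u ∂LL, u ∈ Set.Ico (0:ℝ) 1 := ae_restrict_mem measurableSet_Ico

lemma cell_ext {π π' : Measure (ℝ × ℝ)} (hπ : IsCoupling π LL LL) (hπ' : IsCoupling π' LL LL)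
    {δ : ℝ} (hδ : 0 < δ)
    (h : ∀ k l : ℕ, π (Set.Ico (aa δ k) (aa δ (k + 1)) ×ˢ Set.Ico (aa δ l) (aa δ (l + 1))) =
      π' (Set.Ico (aa δ k) (aa δ (k + 1)) ×ˢ Set.Ico (aa δ l) (aa δ (l + 1)))) :
    π.map (cellMap δ) = π'.map (cellMap δ) := by
  have key : ∀ ρ : Measure (ℝ × ℝ), IsCoupling ρ LL LL → ∀ k l : ℕ,
      ρ (cellMap δ ⁻¹' {((k : ℤ), (l : ℤ))}) =
        ρ (Set.Ico (aa δ k) (aa δ (k + 1)) ×ˢ Set.Ico (aa δ l) (aa δ (l + 1))) := by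
    intro ρ hρ k l
    refine measure_congr ?_
    filter_upwards [coupling_ae hρ LL_mem LL_mem] with p hp
    refine propext ?_
    change cellMap δ p = ((k : ℤ), (l : ℤ)) ↔ _
    rw [cellMap, Prod.mk.injEq, cell_iff hδ hp.1, cell_iff hδ hp.2]
    rfl
  have key0 : ∀ ρ : Measure (ℝ × ℝ), IsCoupling ρ LL LL → ∀ k l : ℤ, (k < 0 ∨ l < 0) →
      ρ (cellMap δ ⁻¹' {(k, l)}) = 0 := by
    intro ρ hρ k l hkl
    refine measure_mono_null (t := {p | ¬ (p.1 ∈ Set.Ico (0:ℝ) 1 ∧ p.2 ∈ Set.Ico (0:ℝ) 1)}) ?_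
      (coupling_ae hρ LL_mem LL_mem)
    rintro p hp ⟨h1, h2⟩
    have hp' : cellMap δ p = (k, l) := hp
    rw [cellMap, Prod.mk.injEq] at hp'
    have p1 : 0 ≤ ⌊p.1 / δ⌋ := Int.floor_nonneg.2 (div_nonneg h1.1 hδ.le)
    have p2 : 0 ≤ ⌊p.2 / δ⌋ := Int.floor_nonneg.2 (div_nonneg h2.1 hδ.le)
    omega
  refine Measure.ext_of_singleton ?_
  rintro ⟨k, l⟩
  rw [Measure.map_apply (cellMap_measurable δ) (measurableSet_singleton _),
    Measure.map_apply (cellMap_measurable δ) (measurableSet_singleton _)]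
  by_cases hkl : k < 0 ∨ l < 0
  · rw [key0 _ hπ _ _ hkl, key0 _ hπ' _ _ hkl]
  · push Not at hkl
    obtain ⟨k, rfl⟩ := Int.eq_ofNat_of_zero_le hkl.1
    obtain ⟨l, rfl⟩ := Int.eq_ofNat_of_zero_le hkl.2
    rw [key _ hπ, key _ hπ', h]

/-- copula of a coupling -/
def cop (π : Measure (ℝ × ℝ)) (a b : ℝ) : ℝ := π.real (Set.Iio a ×ˢ Set.Iio b)

lemma cop_rect (π : Measure (ℝ × ℝ)) [IsFiniteMeasure π] {a a' b b' : ℝ} (ha : a ≤ a')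
    (hb : b ≤ b') : π.real (Set.Ico a a' ×ˢ Set.Ico b b') =
      cop π a' b' - cop π a b' - cop π a' b + cop π a b := by
  have h1 : ∀ d, π.real (Set.Ico a a' ×ˢ Set.Iio d) = cop π a' d - cop π a d := by
    intro d
    have : Set.Ico a a' ×ˢ Set.Iio d = (Set.Iio a' ×ˢ Set.Iio d) \ (Set.Iio a ×ˢ Set.Iio d) := by
      ext ⟨u, v⟩
      simp only [Set.mem_prod, Set.mem_Ico, Set.mem_Iio, Set.mem_diff, not_and, not_lt]
      constructor
      · rintro ⟨⟨h1, h2⟩, h3⟩; exact ⟨⟨h2, h3⟩, fun h => absurd h (not_lt.2 h1)⟩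
      · rintro ⟨⟨h2, h3⟩, h4⟩
        exact ⟨⟨le_of_not_gt fun h => absurd h3 (not_lt.2 (h4 h)), h2⟩, h3⟩
    rw [this, measureReal_diff (Set.prod_mono (Set.Iio_subset_Iio ha) subset_rfl)
      (measurableSet_Iio.prod measurableSet_Iio)]
    rfl
  have h2 : Set.Ico a a' ×ˢ Set.Ico b b' = (Set.Ico a a' ×ˢ Set.Iio b') \ (Set.Ico a a' ×ˢ Set.Iio b) := by
    ext ⟨u, v⟩
    simp only [Set.mem_prod, Set.mem_Ico, Set.mem_Iio, Set.mem_diff, not_and, not_lt]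
    constructor
    · rintro ⟨h1, h2, h3⟩; exact ⟨⟨h1, h3⟩, fun _ => h2⟩
    · rintro ⟨⟨h2, h3⟩, h4⟩; exact ⟨h2, h4 h2, h3⟩
  rw [h2, measureReal_diff (Set.prod_mono subset_rfl (Set.Iio_subset_Iio hb))
      (measurableSet_Ico.prod measurableSet_Iio), h1, h1]
  ring

lemma LL_Ico_le (a a' : ℝ) (h : a ≤ a') : LL.real (Set.Ico a a') ≤ a' - a := by
  rw [measureReal_def]
  refine ENNReal.toReal_le_of_le_ofReal (by linarith) ?_
  rw [← Real.volume_Ico]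
  exact Measure.restrict_apply_le _ _

lemma LL_Iio {a : ℝ} (h0 : 0 ≤ a) (h1 : a ≤ 1) : LL (Set.Iio a) = ENNReal.ofReal a := by
  rw [Measure.restrict_apply measurableSet_Iio, Set.inter_comm, Set.Ico_inter_Iio,
    inf_eq_right.2 h1, Real.volume_Ico, sub_zero]

lemma coupling_swap {π : Measure (ℝ × ℝ)} (hπ : IsCoupling π LL LL) :
    IsCoupling (π.map Prod.swap) LL LL := by
  constructor
  · rw [Measure.map_map measurable_fst measurable_swap]; exact hπ.2
  · rw [Measure.map_map measurable_snd measurable_swap]; exact hπ.1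

lemma cop_swap (π : Measure (ℝ × ℝ)) (a b : ℝ) : cop (π.map Prod.swap) a b = cop π b a := by
  rw [cop, cop, map_measureReal_apply measurable_swap (measurableSet_Iio.prod measurableSet_Iio),
    Set.preimage_swap_prod]

lemma cop_half {π : Measure (ℝ × ℝ)} (hπ : IsCoupling π LL LL) :
    (∀ a, cop π a 0 = 0) ∧ (∀ a, 0 ≤ a → a ≤ 1 → cop π a 1 = a) ∧
    (∀ a a' b, |cop π a b - cop π a' b| ≤ |a - a'|) := by
  have := coupling_prob hπ
  refine ⟨fun a => ?_, fun a h0 h1 => ?_, ?_⟩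
  · rw [cop, measureReal_eq_zero_iff]
    refine measure_mono_null (t := {p | ¬ (p.1 ∈ Set.Ico (0:ℝ) 1 ∧ p.2 ∈ Set.Ico (0:ℝ) 1)}) ?_
      (coupling_ae hπ LL_mem LL_mem)
    rintro p hp ⟨h1, h2⟩
    exact absurd hp.2 (not_lt.2 h2.1)
  · have h2 : π (Set.Iio a ×ˢ Set.Iio 1) = π (Prod.fst ⁻¹' Set.Iio a) := by
      refine measure_congr ?_
      filter_upwards [coupling_ae hπ LL_mem LL_mem] with p hp
      refine propext ?_
      change (p.1 ∈ Set.Iio a ∧ p.2 ∈ Set.Iio 1) ↔ p.1 ∈ Set.Iio a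
      exact ⟨fun h => h.1, fun h => ⟨h, hp.2.2⟩⟩
    rw [cop, measureReal_def, h2, ← Measure.map_apply measurable_fst measurableSet_Iio, hπ.1,
      LL_Iio h0 h1, ENNReal.toReal_ofReal h0]
  · have main : ∀ a a' b, a ≤ a' → |cop π a b - cop π a' b| ≤ |a - a'| := by
      intro a a' b haa
      have hmono : cop π a b ≤ cop π a' b :=
        measureReal_mono (Set.prod_mono (Set.Iio_subset_Iio haa) subset_rfl)
      have hle : cop π a' b ≤ cop π a b + π.real (Prod.fst ⁻¹' Set.Ico a a') := by
        refine (measureReal_mono ?_).trans (measureReal_union_le _ _)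
        rintro ⟨u, v⟩ ⟨h1, h2⟩
        by_cases hu : u < a
        · exact Or.inl ⟨hu, h2⟩
        · exact Or.inr ⟨le_of_not_gt hu, h1⟩
      rw [← map_measureReal_apply measurable_fst measurableSet_Ico, hπ.1] at hle
      have := LL_Ico_le a a' haa
      rw [abs_of_nonpos (by linarith), abs_of_nonpos (by linarith)]
      linarith
    intro a a' b
    rcases le_total a a' with h | h
    · exact main a a' b h
    · rw [abs_sub_comm, abs_sub_comm a]; exact main a' a b h

lemma isCop_cop {π : Measure (ℝ × ℝ)} (hπ : IsCoupling π LL LL) : IsCop (cop π) := by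
  have := coupling_prob hπ
  obtain ⟨h1, h2, h3⟩ := cop_half hπ
  obtain ⟨g1, g2, g3⟩ := cop_half (coupling_swap hπ)
  simp only [cop_swap] at g1 g2 g3
  refine ⟨h1, g1, h2, g2, ?_, ?_⟩
  · intro a a' b b' ha hb
    rw [← cop_rect π ha hb]
    exact measureReal_nonneg
  · intro a a' b b'
    refine (abs_sub_le _ (cop π a' b) _).trans (add_le_add (h3 _ _ _) (g3 _ _ _))

lemma TT_cellMap {π : Measure (ℝ × ℝ)} (hπ : IsCoupling π LL LL) {δ : ℝ} (hδ : 0 < δ) :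
    (LL.map (fun u => (u, TT (cop π) δ u))).map (cellMap δ) = π.map (cellMap δ) := by
  have := coupling_prob hπ
  refine cell_ext (TT_coupling (isCop_cop hπ) hδ).2.2 hπ hδ fun k l => ?_
  rw [TT_cell (isCop_cop hπ) hδ, cc, ← cop_rect π (aa_mono hδ (Nat.le_succ _))
    (aa_mono hδ (Nat.le_succ _)), ofReal_measureReal]

lemma TT_cont {T : Type*} [TopologicalSpace T] {F : T → ℝ → ℝ → ℝ} (hF : ∀ t, IsCop (F t))
    (hFc : Continuous F) {δ : T → ℝ} (hδ : ∀ t, 0 < δ t) (hδc : Continuous δ)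
    (t : T) (tn : ℕ → T) (htn : Tendsto tn atTop (𝓝 t)) :
    ∀ᵐ u ∂LL, Tendsto (fun n => TT (F (tn n)) (δ (tn n)) u) atTop (𝓝 (TT (F t) (δ t) u)) := by
  have ha : ∀ k, Continuous fun s => aa (δ s) k := fun k => by
    unfold aa; fun_prop
  have hFk : ∀ k l, Continuous fun s => F s (aa (δ s) k) (aa (δ s) l) := by
    intro k l
    rw [continuous_iff_continuousAt]
    intro s
    rw [ContinuousAt, tendsto_iff_dist_tendsto_zero]
    have hp : Continuous fun s' => F s' (aa (δ s) k) (aa (δ s) l) :=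
      (continuous_apply _).comp ((continuous_apply _).comp hFc)
    have hlim : Tendsto (fun s' => (|aa (δ s') k - aa (δ s) k| + |aa (δ s') l - aa (δ s) l|) +
        |F s' (aa (δ s) k) (aa (δ s) l) - F s (aa (δ s) k) (aa (δ s) l)|) (𝓝 s) (𝓝 0) := by
      have : Continuous (fun s' => (|aa (δ s') k - aa (δ s) k| + |aa (δ s') l - aa (δ s) l|) +
        |F s' (aa (δ s) k) (aa (δ s) l) - F s (aa (δ s) k) (aa (δ s) l)|) :=
        ((((ha k).sub continuous_const).abs).add (((ha l).sub continuous_const).abs)).add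
          ((hp.sub continuous_const).abs)
      simpa using this.tendsto s
    refine squeeze_zero (fun _ => dist_nonneg) (fun s' => ?_) hlim
    rw [Real.dist_eq]
    refine (abs_sub_le _ (F s' (aa (δ s) k) (aa (δ s) l)) _).trans ?_
    gcongr
    exact (hF s').lip _ _ _ _
  have hx : ∀ i, Continuous fun s => xx (F s) (δ s) i := fun i =>
    ((ha _).add (hFk _ _)).sub (hFk _ _)
  have hy : ∀ i, Continuous fun s => yy (F s) (δ s) i := fun i =>
    ((ha _).add (hFk _ _)).sub (hFk _ _)
  have hcc : ∀ i, Continuous fun s => cc (F s) (δ s) i := fun i =>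
    (((hFk _ _).sub (hFk _ _)).sub (hFk _ _)).add (hFk _ _)
  have hnull : ∀ᵐ u ∂LL, u ∉ Set.range (xx (F t) (δ t)) :=
    (Set.countable_range _).ae_notMem _
  filter_upwards [LL_mem, hnull] with u hu hun
  rw [← (tiles_x (hF t) (hδ t)).2] at hu
  obtain ⟨i, hi⟩ := Set.mem_iUnion.1 hu
  have hlt : xx (F t) (δ t) i < u := lt_of_le_of_ne hi.1 fun h => hun ⟨i, h⟩
  have e1 : ∀ᶠ n in atTop, xx (F (tn n)) (δ (tn n)) i < u :=
    (((hx i).tendsto t).comp htn).eventually (gt_mem_nhds hlt)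
  have e2 : ∀ᶠ n in atTop, u < xx (F (tn n)) (δ (tn n)) i + cc (F (tn n)) (δ (tn n)) i :=
    ((((hx i).add (hcc i)).tendsto t).comp htn).eventually (lt_mem_nhds hi.2)
  have hlim : Tendsto (fun n => u + (yy (F (tn n)) (δ (tn n)) i - xx (F (tn n)) (δ (tn n)) i)) atTop
      (𝓝 (TT (F t) (δ t) u)) := by
    rw [TT, rearr_eq (tiles_x (hF t) (hδ t)) hi]
    exact ((continuous_const.add ((hy i).sub (hx i))).tendsto t).comp htn
  refine hlim.congr' ?_
  filter_upwards [e1, e2] with n h1 h2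
  rw [TT, rearr_eq (tiles_x (hF _) (hδ _)) ⟨h1.le, h2⟩]

lemma H_aemeas {T : Type*} [MetricSpace T] (H : ℝ → ℝ → T → ℝ) (G1 G2 : Set ℝ)
    (hG1 : MeasurableSet G1) (hG2 : MeasurableSet G2)
    (hG1' : ∀ᵐ u ∂LL, u ∈ G1) (hG2' : ∀ᵐ u ∂LL, u ∈ G2)
    (hc : ∀ u ∈ G1, ∀ v ∈ G2, ∀ t, ContinuousAt (fun p : ℝ × ℝ × T => H p.1 p.2.1 p.2.2) (u, v, t))
    (t : T) {π : Measure (ℝ × ℝ)} (hπ : IsCoupling π LL LL) :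
    AEMeasurable (fun p : ℝ × ℝ => ENNReal.ofReal (H p.1 p.2 t)) π := by
  have h1 : ContinuousOn (fun p : ℝ × ℝ => H p.1 p.2 t) (G1 ×ˢ G2) := by
    rintro ⟨u, v⟩ ⟨hu, hv⟩
    refine ContinuousAt.continuousWithinAt ?_
    have := hc u hu v hv t
    exact ContinuousAt.comp (f := fun p : ℝ × ℝ => (p.1, p.2, t)) (x := (u, v)) this
      (by fun_prop)
  have h2 := (h1.aemeasurable (μ := π) (hG1.prod hG2))
  have h3 : π.restrict (G1 ×ˢ G2) = π := by
    refine Measure.restrict_eq_self_of_ae_mem ?_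
    filter_upwards [coupling_ae hπ hG1' hG2'] with p hp using hp
  rw [h3] at h2
  exact h2.ennreal_ofReal

lemma LL_coupling : IsCoupling (LL.prod LL) LL LL := by
  refine ⟨?_, ?_⟩
  · rw [← Measure.fst, Measure.fst_prod]
  · rw [← Measure.snd, Measure.snd_prod]

lemma near_opt (f : Measure (ℝ × ℝ) → ENNReal) {η : ℝ} (hη : 0 < η) :
    ∃ π, IsCoupling π LL LL ∧ ∀ π', IsCoupling π' LL LL → f π ≤ f π' + ENNReal.ofReal η := by
  by_cases hm : (⨅ (π : Measure (ℝ × ℝ)) (_ : IsCoupling π LL LL), f π) = ⊤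
  · refine ⟨_, LL_coupling, fun π' h => ?_⟩
    have : (⊤ : ENNReal) ≤ f π' := hm ▸ iInf₂_le π' h
    rw [top_le_iff.1 this, top_add]
    exact le_top
  · have : (⨅ (π : Measure (ℝ × ℝ)) (_ : IsCoupling π LL LL), f π) <
      (⨅ (π : Measure (ℝ × ℝ)) (_ : IsCoupling π LL LL), f π) + ENNReal.ofReal η :=
      ENNReal.lt_add_right hm (by simpa using hη)
    conv_lhs at this => rfl
    obtain ⟨π, hπ⟩ := iInf_lt_iff.1 this
    obtain ⟨h1, h2⟩ := iInf_lt_iff.1 hπ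
    refine ⟨π, h1, fun π' h' => h2.le.trans ?_⟩
    gcongr
    exact iInf₂_le π' h'

lemma convex_cop (f : ℝ × ℝ → ENNReal) {η : ℝ} (s r : ℝ) (hs : 0 ≤ s) (hr : 0 ≤ r)
    (hsr : s + r = 1) {π1 π2 : Measure (ℝ × ℝ)} (h1 : IsCoupling π1 LL LL)
    (h2 : IsCoupling π2 LL LL)
    (g1 : ∀ π', IsCoupling π' LL LL → ∫⁻ p, f p ∂π1 ≤ ∫⁻ p, f p ∂π' + ENNReal.ofReal η)
    (g2 : ∀ π', IsCoupling π' LL LL → ∫⁻ p, f p ∂π2 ≤ ∫⁻ p, f p ∂π' + ENNReal.ofReal η) :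
    ∃ π, IsCoupling π LL LL ∧
      (∀ π', IsCoupling π' LL LL → ∫⁻ p, f p ∂π ≤ ∫⁻ p, f p ∂π' + ENNReal.ofReal η) ∧
      s • cop π1 + r • cop π2 = cop π := by
  have e1 : ENNReal.ofReal s + ENNReal.ofReal r = 1 := by
    rw [← ENNReal.ofReal_add hs hr, hsr, ENNReal.ofReal_one]
  have i1 := coupling_prob h1
  have i2 := coupling_prob h2
  refine ⟨ENNReal.ofReal s • π1 + ENNReal.ofReal r • π2, ⟨?_, ?_⟩, ?_, ?_⟩
  · rw [Measure.map_add _ _ measurable_fst, Measure.map_smul, Measure.map_smul, h1.1, h2.1,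
      ← add_smul, e1, one_smul]
  · rw [Measure.map_add _ _ measurable_snd, Measure.map_smul, Measure.map_smul, h1.2, h2.2,
      ← add_smul, e1, one_smul]
  · intro π' h'
    rw [lintegral_add_measure, lintegral_smul_measure, lintegral_smul_measure]
    calc _ ≤ ENNReal.ofReal s • (∫⁻ p, f p ∂π' + ENNReal.ofReal η) +
          ENNReal.ofReal r • (∫⁻ p, f p ∂π' + ENNReal.ofReal η) := by
            gcongr
            · exact g1 π' h'
            · exact g2 π' h'
      _ = _ := by rw [← add_smul, e1, one_smul]
  · funext a b
    simp only [Pi.add_apply, Pi.smul_apply, cop, smul_eq_mul]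
    have j1 : (ENNReal.ofReal s • π1) (Set.Iio a ×ˢ Set.Iio b) ≠ ⊤ := by
      rw [Measure.smul_apply, smul_eq_mul]
      exact ENNReal.mul_ne_top ENNReal.ofReal_ne_top (measure_ne_top _ _)
    have j2 : (ENNReal.ofReal r • π2) (Set.Iio a ×ˢ Set.Iio b) ≠ ⊤ := by
      rw [Measure.smul_apply, smul_eq_mul]
      exact ENNReal.mul_ne_top ENNReal.ofReal_ne_top (measure_ne_top _ _)
    rw [measureReal_add_apply j1 j2, measureReal_ennreal_smul_apply, measureReal_ennreal_smul_apply,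
      ENNReal.toReal_ofReal hs, ENNReal.toReal_ofReal hr]

lemma core {T : Type*} [MetricSpace T] (H : ℝ → ℝ → T → ℝ) (G1 G2 : Set ℝ)
    (hG1 : MeasurableSet G1) (hG2 : MeasurableSet G2)
    (hG1' : ∀ᵐ u ∂LL, u ∈ G1) (hG2' : ∀ᵐ u ∂LL, u ∈ G2)
    (hc : ∀ u ∈ G1, ∀ v ∈ G2, ∀ t, ContinuousAt (fun p : ℝ × ℝ × T => H p.1 p.2.1 p.2.2) (u, v, t))
    (α β : T → ℝ → ℝ) (hα : ∀ t, Measurable (α t)) (hβ : ∀ t, Measurable (β t))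
    (hdom : ∀ t u v, H u v t ≤ α t u + β t v)
    (hUI : ∀ ε > (0:ℝ), ∃ R : ℝ, 0 ≤ R ∧ ∀ t,
      (∫⁻ u, (if R ≤ α t u then ENNReal.ofReal (α t u) else 0) ∂LL ≤ ENNReal.ofReal ε) ∧
      (∫⁻ u, (if R ≤ β t u then ENNReal.ofReal (β t u) else 0) ∂LL ≤ ENNReal.ofReal ε))
    {ε : ℝ} (hε : 0 < ε) :
    ∃ Tm : T → ℝ → ℝ, (∀ t, Measurable (Tm t)) ∧ (∀ t, LL.map (Tm t) = LL) ∧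
      (∀ t π, IsCoupling π LL LL → ∫⁻ u, ENNReal.ofReal (H u (Tm t u) t) ∂LL ≤
        ∫⁻ p, ENNReal.ofReal (H p.1 p.2 t) ∂π + ENNReal.ofReal ε) ∧
      (∀ (t : T) (tn : ℕ → T), Tendsto tn atTop (𝓝 t) →
        ∀ᵐ u ∂LL, Tendsto (fun n => Tm (tn n) u) atTop (𝓝 (Tm t u))) := by
  let S : T → Set (ℝ → ℝ → ℝ) := fun t => {F | ∃ π, IsCoupling π LL LL ∧
    (∀ π', IsCoupling π' LL LL → ∫⁻ p, ENNReal.ofReal (H p.1 p.2 t) ∂π ≤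
      ∫⁻ p, ENNReal.ofReal (H p.1 p.2 t) ∂π' + ENNReal.ofReal (ε / 2)) ∧ F = cop π}
  have hS : ∀ t, Convex ℝ (S t) := by
    rintro t _ ⟨π1, h1, g1, rfl⟩ _ ⟨π2, h2, g2, rfl⟩ s r hs hr hsr
    exact convex_cop _ s r hs hr hsr h1 h2 g1 g2
  have hloc : ∀ t0, ∃ F, ∀ᶠ t in 𝓝 t0, F ∈ S t := by
    intro t0
    obtain ⟨π0, hπ0, hopt⟩ := near_opt (fun π => ∫⁻ p, ENNReal.ofReal (H p.1 p.2 t0) ∂π)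
      (η := ε / 4) (by linarith)
    obtain ⟨δ0, hδ0, hA⟩ := lemmaA H G1 G2 hG1 hG2 hG1' hG2' hc α β hα hβ hdom hUI t0
      (ε := ε / 8) (by linarith)
    refine ⟨cop π0, ?_⟩
    filter_upwards [Metric.ball_mem_nhds t0 hδ0] with t ht
    refine ⟨π0, hπ0, fun π' h' => ?_, rfl⟩
    have hm : t0 ∈ Metric.ball t0 δ0 := Metric.mem_ball_self hδ0
    calc _ ≤ _ := hA t ht t0 hm δ0 hδ0 le_rfl π0 π0 hπ0 hπ0 rfl
      _ ≤ _ := add_le_add_left (hopt π' h') _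
      _ ≤ _ := add_le_add_left (add_le_add_left
          (hA t0 hm t ht δ0 hδ0 le_rfl π' π' h' h' rfl) _) _
      _ = _ := by
        rw [add_assoc, add_assoc, ← ENNReal.ofReal_add (by linarith) (by linarith),
          ← ENNReal.ofReal_add (by linarith) (by linarith)]
        congr 2
        ring
  obtain ⟨F, hF⟩ := exists_continuous_forall_mem_convex_of_local_const hS hloc
  choose δ0 hδ0 hA using fun t0 => lemmaA H G1 G2 hG1 hG2 hG1' hG2' hc α β hα hβ hdom hUI t0
      (ε := ε / 2) (by linarith)
  let S' : T → Set ℝ := fun t => {y | 0 < y ∧ ∃ s, t ∈ Metric.ball s (δ0 s) ∧ y ≤ δ0 s}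
  have hS' : ∀ t, Convex ℝ (S' t) := by
    intro t
    refine Set.OrdConnected.convex ⟨?_⟩
    rintro x hx y ⟨hy, s, hs, hys⟩ z hz
    exact ⟨hx.1.trans_le hz.1, s, hs, hz.2.trans hys⟩
  have hloc' : ∀ t0, ∃ y, ∀ᶠ t in 𝓝 t0, y ∈ S' t := by
    intro t0
    refine ⟨δ0 t0, ?_⟩
    filter_upwards [Metric.ball_mem_nhds t0 (hδ0 t0)] with t ht
    exact ⟨hδ0 t0, t0, ht, le_rfl⟩
  obtain ⟨δ, hδ⟩ := exists_continuous_forall_mem_convex_of_local_const hS' hloc'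
  choose π hπ hopt hFπ using hF
  have hcop : ∀ t, IsCop (F t) := fun t => by rw [hFπ t]; exact isCop_cop (hπ t)
  have hpos : ∀ t, 0 < δ t := fun t => (hδ t).1
  have hTT := fun t => TT_coupling (hcop t) (hpos t)
  refine ⟨fun t => TT (F t) (δ t), fun t => (hTT t).1, fun t => (hTT t).2.1, ?_, ?_⟩
  · intro t π' h'
    obtain ⟨-, s, hs, hle⟩ := hδ t
    have hm : Measurable (fun u => (u, TT (F t) (δ t) u)) := measurable_id.prodMk (hTT t).1
    have e1 : ∫⁻ u, ENNReal.ofReal (H u (TT (F t) (δ t) u) t) ∂LL =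
        ∫⁻ p, ENNReal.ofReal (H p.1 p.2 t) ∂(LL.map (fun u => (u, TT (F t) (δ t) u))) := by
      rw [lintegral_map' (H_aemeas H G1 G2 hG1 hG2 hG1' hG2' hc t (hTT t).2.2) hm.aemeasurable]
    rw [e1]
    have e2 := TT_cellMap (hπ t) (hpos t)
    rw [← hFπ t] at e2
    calc _ ≤ _ := hA s t hs t hs (δ t) (hpos t) hle _ (π t) (hTT t).2.2 (hπ t) e2
      _ ≤ _ := add_le_add_left (hopt t π' h') _
      _ = _ := by
        rw [add_assoc, ← ENNReal.ofReal_add (by linarith) (by linarith), add_halves]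
  · intro t tn htn
    exact TT_cont hcop F.continuous hpos δ.continuous t tn htn

open ProbabilityTheory in
lemma map_eq_insep {Z X : Type*} [MeasurableSpace Z] [TopologicalSpace X] [MeasurableSpace X]
    [BorelSpace X] (ρ : Measure Z) {f g : Z → X} (hf : Measurable f) (hg : Measurable g)
    (h : ∀ᵐ z ∂ρ, Inseparable (f z) (g z)) : ρ.map f = ρ.map g := by
  ext B hB
  rw [Measure.map_apply hf hB, Measure.map_apply hg hB]
  refine measure_congr ?_
  filter_upwards [h] with z hz
  exact propext (hz.mem_measurableSet_iff hB)

lemma qf_good (lam : Measure ℝ) [IsProbabilityMeasure lam] {X : Type*} [TopologicalSpace X]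
    {C : Set ℝ} (hC : IsClosed C) (h1 : ∀ᵐ r ∂lam, r ∈ C) {ψ : ℝ → X} (hψ : ContinuousOn ψ C) :
    ∃ G : Set ℝ, MeasurableSet G ∧ (∀ᵐ u ∂LL, u ∈ G) ∧
      ∀ u ∈ G, ContinuousAt (fun u => ψ (qf lam u)) u := by
  have hcnt := (qf_mono lam).countable_not_continuousWithinAt
  refine ⟨Set.Ioo 0 1 \ _, measurableSet_Ioo.diff hcnt.measurableSet, ?_, ?_⟩
  · have h2 : ∀ᵐ u ∂LL, u ∉ {x | x ∈ Set.Ioo (0:ℝ) 1 ∧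
        ¬ContinuousWithinAt (qf lam) (Set.Ioo 0 1) x} := by
      refine ae_restrict_of_ae ?_
      exact measure_eq_zero_iff_ae_notMem.1 (hcnt.measure_zero _)
    filter_upwards [LL_ae_Ioo, h2] with u h3 h4 using ⟨h3, h4⟩
  · rintro u ⟨hu, hu'⟩
    have hw : ContinuousWithinAt (qf lam) (Set.Ioo 0 1) u := by
      by_contra hn
      exact hu' ⟨hu, hn⟩
    have hnh : Set.Ioo (0:ℝ) 1 ∈ 𝓝 u := isOpen_Ioo.mem_nhds hu
    have ha : ContinuousAt (qf lam) u := hw.continuousAt hnh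
    have hm := qf_mem lam hC h1 hu
    have ht : Tendsto (qf lam) (𝓝 u) (𝓝[C] (qf lam u)) := by
      refine tendsto_nhdsWithin_iff.2 ⟨ha, ?_⟩
      filter_upwards [hnh] with v hv using qf_mem lam hC h1 hv
    exact (hψ _ hm).tendsto.comp ht

lemma param_X {X : Type*} [TopologicalSpace X] [CompletelyRegularSpace X]
    [MeasurableSpace X] [BorelSpace X] (μ : Measure X) [IsProbabilityMeasure μ]
    [NullSingletonClass μ]
    (hconc : ∃ K : ℕ → Set X, (∀ n, IsCompact (K n)) ∧
      (∀ n, TopologicalSpace.MetrizableSpace (K n)) ∧ μ (⋃ n, K n) = 1) :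
    ∃ (p : ℝ → X) (G : Set ℝ) (U : X → ℝ), Measurable p ∧ MeasurableSet G ∧
      (∀ᵐ u ∂LL, u ∈ G) ∧ (∀ u ∈ G, ContinuousAt p u) ∧ LL.map p = μ ∧ Measurable U ∧
      μ.map U = LL ∧ ∀ᵐ x ∂μ, Inseparable (p (U x)) x := by
  obtain ⟨C, ψ, e, hC, hψc, hψ, he, hae⟩ := aux_param μ hconc
  have hprob : IsProbabilityMeasure (μ.map e) := Measure.isProbabilityMeasure_map he.aemeasurable
  have hna : NullSingletonClass (μ.map e) := by
    refine ⟨fun r => ?_⟩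
    rw [Measure.map_apply he (measurableSet_singleton r)]
    have h0 : μ (toMeasurable μ {ψ r}) = 0 := by rw [measure_toMeasurable, measure_singleton]
    have h1 : ∀ᵐ x ∂μ, x ∉ toMeasurable μ {ψ r} := measure_eq_zero_iff_ae_notMem.1 h0
    rw [measure_eq_zero_iff_ae_notMem]
    filter_upwards [hae, h1] with x hx hx' hr
    have hr' : e x = r := hr
    rw [hr'] at hx
    exact hx' ((hx.2.mem_measurableSet_iff (measurableSet_toMeasurable _ _)).1
      (subset_toMeasurable _ _ rfl))
  have hCae : ∀ᵐ r ∂(μ.map e), r ∈ C := by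
    refine (ae_map_iff he.aemeasurable hC.measurableSet).2 ?_
    exact hae.mono fun x hx => hx.1
  obtain ⟨G, hG, hG', hGc⟩ := qf_good (μ.map e) hC hCae hψc
  have hqm := qf_measurable (μ.map e)
  have hqq := qf_map (μ.map e)
  have hp : Measurable (fun u => ψ (qf (μ.map e) u)) := hψ.comp hqm
  have hcdf : Measurable (ProbabilityTheory.cdf (μ.map e)) :=
    (ProbabilityTheory.monotone_cdf _).measurable
  have hU : Measurable (fun x => ProbabilityTheory.cdf (μ.map e) (e x)) := hcdf.comp he
  have hUm : μ.map (fun x => ProbabilityTheory.cdf (μ.map e) (e x)) = LL := by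
    have e1 : μ.map (fun x => ProbabilityTheory.cdf (μ.map e) (e x)) =
        (μ.map e).map (ProbabilityTheory.cdf (μ.map e)) := by
      rw [Measure.map_map hcdf he]; rfl
    have e2 : (LL.map (qf (μ.map e))).map (ProbabilityTheory.cdf (μ.map e)) = LL := by
      rw [Measure.map_map hcdf hqm]
      conv_rhs => rw [← Measure.map_id (μ := LL)]
      refine Measure.map_congr ?_
      filter_upwards [LL_ae_Ioo] with u hu using qf_cdf _ hu
    rw [e1]
    rw [hqq] at e2
    exact e2
  have hins : ∀ᵐ x ∂μ, Inseparable
      (ψ (qf (μ.map e) (ProbabilityTheory.cdf (μ.map e) (e x)))) x := by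
    have h1 : ∀ᵐ r ∂(LL.map (qf (μ.map e))),
        qf (μ.map e) (ProbabilityTheory.cdf (μ.map e) r) = r := by
      refine (ae_map_iff hqm.aemeasurable
        (measurableSet_eq_fun (hqm.comp hcdf) measurable_id)).2 ?_
      filter_upwards [LL_ae_Ioo] with u hu
      exact congrArg _ (qf_cdf _ hu)
    rw [hqq] at h1
    filter_upwards [hae, ae_of_ae_map he.aemeasurable h1] with x hx hx'
    rw [hx']
    exact hx.2
  refine ⟨fun u => ψ (qf (μ.map e) u), G, _, hp, hG, hG', hGc, ?_, hU, hUm, hins⟩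
  conv_lhs => rw [← hUm]
  rw [Measure.map_map hp hU]
  conv_rhs => rw [← Measure.map_id (μ := μ)]
  exact map_eq_insep μ (hp.comp hU) measurable_id hins

open ProbabilityTheory in
lemma param_Y {Y : Type*} [TopologicalSpace Y] [CompletelyRegularSpace Y]
    [MeasurableSpace Y] [BorelSpace Y] (ν : Measure Y) [IsProbabilityMeasure ν]
    (hconc : ∃ K : ℕ → Set Y, (∀ n, IsCompact (K n)) ∧
      (∀ n, TopologicalSpace.MetrizableSpace (K n)) ∧ ν (⋃ n, K n) = 1) :
    ∃ (q : ℝ → Y) (G : Set ℝ) (κ : Kernel Y ℝ), Measurable q ∧ MeasurableSet G ∧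
      (∀ᵐ u ∂LL, u ∈ G) ∧ (∀ u ∈ G, ContinuousAt q u) ∧ LL.map q = ν ∧ IsMarkovKernel κ ∧
      (ν ⊗ₘ κ).map Prod.snd = LL ∧ ∀ᵐ z ∂(ν ⊗ₘ κ), Inseparable (q z.2) z.1 := by
  obtain ⟨C, ψ, e, hC, hψc, hψ, he, hae⟩ := aux_param ν hconc
  have hprob : IsProbabilityMeasure (ν.map e) := Measure.isProbabilityMeasure_map he.aemeasurable
  have hCae : ∀ᵐ r ∂(ν.map e), r ∈ C := by
    refine (ae_map_iff he.aemeasurable hC.measurableSet).2 ?_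
    exact hae.mono fun x hx => hx.1
  obtain ⟨G, hG, hG', hGc⟩ := qf_good (ν.map e) hC hCae hψc
  have hqm := qf_measurable (ν.map e)
  have hqq := qf_map (ν.map e)
  have hp : Measurable (fun u => ψ (qf (ν.map e) u)) := hψ.comp hqm
  let κ0 : Kernel ℝ ℝ := condDistrib id (qf (ν.map e)) LL
  have hk : (ν.map e) ⊗ₘ κ0 = LL.map (fun u => (qf (ν.map e) u, u)) := by
    have := compProd_map_condDistrib (μ := LL) (X := qf (ν.map e)) (Y := id)
      (mβ := inferInstance) aemeasurable_id
    rw [hqq] at this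
    exact this
  let κ : Kernel Y ℝ := κ0.comap e he
  have hsnd : (ν ⊗ₘ κ).map Prod.snd = LL := by
    have h1 : ((ν.map e) ⊗ₘ κ0).map Prod.snd = LL := by
      have hpm : Measurable (fun u => (qf (ν.map e) u, u)) := hqm.prodMk measurable_id
      rw [hk, Measure.map_map measurable_snd hpm]
      exact Measure.map_id
    rw [← h1]
    ext B hB
    rw [Measure.map_apply measurable_snd hB, Measure.map_apply measurable_snd hB,
      Measure.compProd_apply (measurable_snd hB), Measure.compProd_apply (measurable_snd hB),
      lintegral_map _ he]
    · rfl
    · exact Kernel.measurable_kernel_prodMk_left (measurable_snd hB)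
  have hins : ∀ᵐ z ∂(ν ⊗ₘ κ), Inseparable (ψ (qf (ν.map e) z.2)) z.1 := by
    have h1 : ∀ᵐ z ∂((ν.map e) ⊗ₘ κ0), qf (ν.map e) z.2 = z.1 := by
      rw [hk]
      refine (ae_map_iff (hqm.prodMk measurable_id).aemeasurable
        (measurableSet_eq_fun (hqm.comp measurable_snd) measurable_fst)).2 ?_
      exact ae_of_all _ fun _ => rfl
    have h2 := Measure.ae_ae_of_ae_compProd h1
    have h3 := ae_of_ae_map he.aemeasurable h2
    have h4 : ∀ᵐ z ∂(ν ⊗ₘ κ), qf (ν.map e) z.2 = e z.1 := by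
      refine (Measure.ae_compProd_iff
        (measurableSet_eq_fun (hqm.comp measurable_snd) (he.comp measurable_fst))).2 ?_
      exact h3
    have h5 : ∀ᵐ z ∂(ν ⊗ₘ κ), Inseparable (ψ (e z.1)) z.1 := by
      have : (ν ⊗ₘ κ).map Prod.fst = ν := Measure.fst_compProd ν κ
      have h6 := hae
      rw [← this] at h6
      exact (ae_of_ae_map measurable_fst.aemeasurable h6).mono fun z hz => hz.2
    filter_upwards [h4, h5] with z h6 h7
    rw [h6]
    exact h7
  refine ⟨fun u => ψ (qf (ν.map e) u), G, κ, hp, hG, hG', hGc, ?_, inferInstance,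
    hsnd, hins⟩
  conv_lhs => rw [← hsnd]
  rw [Measure.map_map hp measurable_snd]
  have : (ν ⊗ₘ κ).map Prod.fst = ν := Measure.fst_compProd ν κ
  conv_rhs => rw [← this]
  exact map_eq_insep _ (hp.comp measurable_snd) measurable_fst hins

open ProbabilityTheory in
lemma lift_coupling {X Y : Type*} [MeasurableSpace X] [MeasurableSpace Y]
    {μ : Measure X} {ν : Measure Y} [IsProbabilityMeasure μ] [IsProbabilityMeasure ν]
    {U : X → ℝ} (hU : Measurable U) (hUm : μ.map U = LL) (κ : Kernel Y ℝ) [IsMarkovKernel κ]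
    (hsnd : (ν ⊗ₘ κ).map Prod.snd = LL) {P : Y × ℝ → Prop} (hP : ∀ᵐ z ∂(ν ⊗ₘ κ), P z)
    {Q : X → Prop} (hQ : ∀ᵐ x ∂μ, Q x)
    (f : X × Y → ENNReal) (H : ℝ × ℝ → ENNReal)
    (hfH : ∀ x y v, Q x → P (y, v) → H (U x, v) = f (x, y))
    {σ : Measure (X × Y)} (hσ : IsCoupling σ μ ν) :
    ∃ π, IsCoupling π LL LL ∧ ∫⁻ p, H p ∂π ≤ ∫⁻ p, f p ∂σ := by
  have hσp : IsProbabilityMeasure σ := by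
    have : IsProbabilityMeasure (σ.map Prod.fst) := by rw [hσ.1]; infer_instance
    exact Measure.isProbabilityMeasure_of_map Prod.fst
  let κ' : Kernel (X × Y) ℝ := κ.comap Prod.snd measurable_snd
  have hm : Measurable (fun z : (X × Y) × ℝ => (z.1.2, z.2)) := by fun_prop
  have hUm' : Measurable (fun z : (X × Y) × ℝ => (U z.1.1, z.2)) := by fun_prop
  have h1 : (σ ⊗ₘ κ').map (fun z => (z.1.2, z.2)) = ν ⊗ₘ κ := by
    ext B hB
    rw [Measure.map_apply hm hB, Measure.compProd_apply (hm hB), Measure.compProd_apply hB,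
      ← hσ.2, lintegral_map _ measurable_snd]
    · rfl
    · exact Kernel.measurable_kernel_prodMk_left hB
  have h2 : (σ ⊗ₘ κ').map Prod.fst = σ := Measure.fst_compProd σ κ'
  have hP' : ∀ᵐ z ∂(σ ⊗ₘ κ'), P (z.1.2, z.2) := by
    rw [← h1] at hP
    exact ae_of_ae_map hm.aemeasurable hP
  have h3 : (σ ⊗ₘ κ').map (fun z => z.1.1) = μ := by
    rw [← hσ.1]
    conv_rhs => rw [← h2]
    rw [Measure.map_map measurable_fst measurable_fst]
    rfl
  have hQ' : ∀ᵐ z ∂(σ ⊗ₘ κ'), Q z.1.1 := by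
    rw [← h3] at hQ
    exact ae_of_ae_map (measurable_fst.comp measurable_fst).aemeasurable hQ
  refine ⟨(σ ⊗ₘ κ').map (fun z => (U z.1.1, z.2)), ⟨?_, ?_⟩, ?_⟩
  · rw [Measure.map_map measurable_fst hUm', ← hUm]
    conv_rhs => rw [← h3]
    have hff : Measurable (fun z : (X × Y) × ℝ => z.1.1) := by fun_prop
    rw [Measure.map_map hU hff]
    rfl
  · rw [Measure.map_map measurable_snd hUm', ← hsnd, ← h1, Measure.map_map measurable_snd hm]
    rfl
  · calc _ ≤ ∫⁻ z, H (U z.1.1, z.2) ∂(σ ⊗ₘ κ') := lintegral_map_le _ _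
      _ = ∫⁻ z, f z.1 ∂(σ ⊗ₘ κ') := by
        refine lintegral_congr_ae ?_
        filter_upwards [hP', hQ'] with z hz hz'
        exact hfH _ _ _ hz' hz
      _ ≤ ∫⁻ p, f p ∂σ := by
        obtain ⟨g, hg, hgf, hge⟩ := exists_measurable_le_lintegral_eq (σ ⊗ₘ κ') (fun z => f z.1)
        rw [hge, Measure.lintegral_compProd hg]
        refine lintegral_mono fun p => ?_
        calc _ ≤ ∫⁻ _, f p ∂(κ' p) := lintegral_mono fun v => hgf (p, v)
          _ = f p := by simp

lemma ui_aux {X : Type*} [MeasurableSpace X] {μ : Measure X} {p : ℝ → X} (hp : Measurable p)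
    (hpm : LL.map p = μ) {a : X → ℝ} (ha : Measurable a) (ha0 : ∀ x, 0 ≤ a x)
    (hai : Integrable a μ) {R η : ℝ} (h : ∫ x in {x | R ≤ a x}, a x ∂μ ≤ η) :
    ∫⁻ u, (if R ≤ a (p u) then ENNReal.ofReal (a (p u)) else 0) ∂LL ≤ ENNReal.ofReal η := by
  have hS : MeasurableSet {x | R ≤ a x} := measurableSet_le measurable_const ha
  have hm : Measurable (fun x => if R ≤ a x then ENNReal.ofReal (a x) else 0) :=
    Measurable.ite hS ha.ennreal_ofReal measurable_const
  calc _ = ∫⁻ x, (if R ≤ a x then ENNReal.ofReal (a x) else 0) ∂μ := by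
        rw [← hpm, lintegral_map hm hp]
    _ = ∫⁻ x in {x | R ≤ a x}, ENNReal.ofReal (a x) ∂μ := by
        rw [← lintegral_indicator hS]
        rfl
    _ = ENNReal.ofReal (∫ x in {x | R ≤ a x}, a x ∂μ) := by
        rw [ofReal_integral_eq_lintegral_ofReal hai.integrableOn (ae_of_all _ ha0)]
    _ ≤ _ := ENNReal.ofReal_le_ofReal h

/-- **Theorem 2 of the paper.** Fixed marginals: `μ` a non-atomic Radon
probability measure on a completely regular space `X`, `ν` a Radon probability measure
on a completely regular space `Y`, both concentrated on countable unions of metrizable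
compact sets; `h` a continuous nonnegative cost function depending on a parameter `t`
from a metric space and satisfying the uniform integrability bound. Then for every
`ε > 0` one can select `ε`-optimal Monge mappings `T_t` with `μ ∘ T_t⁻¹ = ν`, continuous
in `t` in the sense of convergence `μ`-a.e. -/
theorem approx_monge_fixed_marginals
    {X Y T : Type*} [TopologicalSpace X] [CompletelyRegularSpace X]
    [TopologicalSpace Y] [CompletelyRegularSpace Y] [MetricSpace T]
    [MeasurableSpace X] [BorelSpace X] [MeasurableSpace Y] [BorelSpace Y]
    (μ : Measure X) (ν : Measure Y)
    (hμp : IsProbabilityMeasure μ) (hνp : IsProbabilityMeasure ν)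
    (hμna : NoAtoms μ) (hμr : μ.InnerRegular) (hνr : ν.InnerRegular)
    (hμconc : ∃ K : ℕ → Set X, (∀ n, IsCompact (K n)) ∧
      (∀ n, TopologicalSpace.MetrizableSpace (K n)) ∧ μ (⋃ n, K n) = 1)
    (hνconc : ∃ K : ℕ → Set Y, (∀ n, IsCompact (K n)) ∧
      (∀ n, TopologicalSpace.MetrizableSpace (K n)) ∧ ν (⋃ n, K n) = 1)
    (h : X → Y → T → ℝ)
    (hcont : Continuous fun p : X × Y × T => h p.1 p.2.1 p.2.2)
    (hnonneg : ∀ x y t, 0 ≤ h x y t)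
    (a : T → X → ℝ) (b : T → Y → ℝ)
    (hameas : ∀ t, Measurable (a t)) (hbmeas : ∀ t, Measurable (b t))
    (ha0 : ∀ t x, 0 ≤ a t x) (hb0 : ∀ t y, 0 ≤ b t y)
    (haint : ∀ t, Integrable (a t) μ) (hbint : ∀ t, Integrable (b t) ν)
    (hdom : ∀ t x y, h x y t ≤ a t x + b t y)
    (hunif : ∀ ε > (0 : ℝ), ∃ R₀ : ℝ, ∀ R ≥ R₀, ∀ t : T,
      (∫ x in {x | R ≤ a t x}, a t x ∂μ) + ∫ y in {y | R ≤ b t y}, b t y ∂ν ≤ ε)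
    (ε : ℝ) (hε : 0 < ε) :
    ∃ Tm : T → X → Y,
      (∀ t, Measurable (Tm t)) ∧
      (∀ t, μ.map (Tm t) = ν) ∧
      (∀ t, (∫⁻ x, ENNReal.ofReal (h x (Tm t x) t) ∂μ) ≤
        kantorovichCost (fun x y => h x y t) μ ν + ENNReal.ofReal ε) ∧
      (∀ (t : T) (tn : ℕ → T), Tendsto tn atTop (𝓝 t) →
        ∀ᵐ x ∂μ, Tendsto (fun n => Tm (tn n) x) atTop (𝓝 (Tm t x))) := by
  have hna : NullSingletonClass μ := hμna
  obtain ⟨p, G1, U, hp, hG1, hG1', hpc, hpm, hU, hUm, hUi⟩ := param_X μ hμconc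
  obtain ⟨q, G2, κ, hq, hG2, hG2', hqc, hqm, hκ, hκs, hκi⟩ := param_Y ν hνconc
  have hc : ∀ u ∈ G1, ∀ v ∈ G2, ∀ t, ContinuousAt
      (fun z : ℝ × ℝ × T => h (p z.1) (q z.2.1) z.2.2) (u, v, t) := by
    intro u hu v hv t
    have h1 : ContinuousAt (fun z : ℝ × ℝ × T => (p z.1, q z.2.1, z.2.2)) (u, v, t) := by
      refine ContinuousAt.prodMk ?_ (ContinuousAt.prodMk ?_ (by fun_prop))
      · exact ContinuousAt.comp (f := fun z : ℝ × ℝ × T => z.1) (x := (u, v, t)) (hpc u hu)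
          (by fun_prop)
      · exact ContinuousAt.comp (f := fun z : ℝ × ℝ × T => z.2.1) (x := (u, v, t)) (hqc v hv)
          (by fun_prop)
    exact ContinuousAt.comp (f := fun z : ℝ × ℝ × T => (p z.1, q z.2.1, z.2.2))
      (x := (u, v, t)) hcont.continuousAt h1
  have hins : ∀ x x' y y' t, Inseparable x x' → Inseparable y y' → h x y t = h x' y' t := by
    intro x x' y y' t hx hy
    exact ((hx.prod (hy.prod (Inseparable.refl t))).map hcont).eq
  have hUI : ∀ ε > (0:ℝ), ∃ R : ℝ, 0 ≤ R ∧ ∀ t,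
      (∫⁻ u, (if R ≤ a t (p u) then ENNReal.ofReal (a t (p u)) else 0) ∂LL ≤
        ENNReal.ofReal ε) ∧
      (∫⁻ u, (if R ≤ b t (q u) then ENNReal.ofReal (b t (q u)) else 0) ∂LL ≤
        ENNReal.ofReal ε) := by
    intro η hη
    obtain ⟨R₀, hR⟩ := hunif η hη
    refine ⟨max R₀ 0, le_max_right _ _, fun t => ?_⟩
    have h1 := hR (max R₀ 0) (le_max_left _ _) t
    have h2 : 0 ≤ ∫ x in {x | max R₀ 0 ≤ a t x}, a t x ∂μ := integral_nonneg (ha0 t)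
    have h3 : 0 ≤ ∫ y in {y | max R₀ 0 ≤ b t y}, b t y ∂ν := integral_nonneg (hb0 t)
    exact ⟨ui_aux hp hpm (hameas t) (ha0 t) (haint t) (by linarith),
      ui_aux hq hqm (hbmeas t) (hb0 t) (hbint t) (by linarith)⟩
  obtain ⟨Tm, hTm, hTmap, hTc, hTt⟩ := core (fun u v t => h (p u) (q v) t) G1 G2 hG1 hG2 hG1' hG2'
    hc (fun t u => a t (p u)) (fun t v => b t (q v)) (fun t => (hameas t).comp hp)
    (fun t => (hbmeas t).comp hq) (fun t u v => hdom t _ _) hUI hε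
  have hmm : ∀ t, Measurable (fun x => q (Tm t (U x))) := fun t => hq.comp ((hTm t).comp hU)
  refine ⟨fun t x => q (Tm t (U x)), hmm, ?_, ?_, ?_⟩
  · intro t
    rw [← hqm]
    conv_rhs => rw [← hTmap t, ← hUm]
    rw [Measure.map_map (hTm t) hU, Measure.map_map hq ((hTm t).comp hU)]
    rfl
  · intro t
    have hcpl : IsCoupling (LL.map (fun u => (u, Tm t u))) LL LL := by
      have hm : Measurable (fun u => (u, Tm t u)) := measurable_id.prodMk (hTm t)
      refine ⟨?_, ?_⟩
      · rw [Measure.map_map measurable_fst hm]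
        exact Measure.map_id
      · rw [Measure.map_map measurable_snd hm]
        exact hTmap t
    have hae : AEMeasurable (fun u => ENNReal.ofReal (h (p u) (q (Tm t u)) t)) LL :=
      (H_aemeas (fun u v t => h (p u) (q v) t) G1 G2 hG1 hG2 hG1' hG2' hc t
        hcpl).comp_measurable (measurable_id.prodMk (hTm t))
    have e1 : ∫⁻ x, ENNReal.ofReal (h x (q (Tm t (U x))) t) ∂μ =
        ∫⁻ u, ENNReal.ofReal (h (p u) (q (Tm t u)) t) ∂LL := by
      have hae' := hae
      rw [← hUm] at hae'
      conv_rhs => rw [← hUm]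
      rw [lintegral_map' hae' hU.aemeasurable]
      refine lintegral_congr_ae ?_
      filter_upwards [hUi] with x hx
      rw [hins _ _ _ _ t hx (Inseparable.refl _)]
    change ∫⁻ x, ENNReal.ofReal (h x (q (Tm t (U x))) t) ∂μ ≤ _
    rw [e1, ← tsub_le_iff_right]
    refine le_iInf₂ fun σ hσ => ?_
    rw [tsub_le_iff_right]
    obtain ⟨π, hπ, hle⟩ := lift_coupling hU hUm κ hκs hκi hUi
      (fun z => ENNReal.ofReal (h z.1 z.2 t)) (fun z => ENNReal.ofReal (h (p z.1) (q z.2) t))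
      (fun x y v hx hy => by rw [hins _ _ _ _ t hx hy]) hσ
    exact (hTc t π hπ).trans (add_le_add_left hle _)
  · intro t tn htn
    have h1 := hTt t tn htn
    have h2 : ∀ᵐ u ∂LL, Tm t u ∈ G2 := by
      have := hG2'
      rw [← hTmap t] at this
      exact ae_of_ae_map (hTm t).aemeasurable this
    have h3 : ∀ᵐ u ∂LL, Tendsto (fun n => q (Tm (tn n) u)) atTop (𝓝 (q (Tm t u))) := by
      filter_upwards [h1, h2] with u h4 h5
      exact (hqc _ h5).tendsto.comp h4
    rw [← hUm] at h3
    exact ae_of_ae_map hU.aemeasurable h3
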